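/- arXiv:1507.02166 — 2 statements merged into one kernel-verified Lean document; each statement's English description precedes it below -/
import Mathlib

section
/- Let γ > 0, β > 2 and let π be a positive C³ probability density on ℝ belonging to the class ℰ(β,γ). Fix h > 0 and let Q be the Markov kernel on ℝ of the unadjusted scheme mUOA, namely Q(x,·) = N(μ^{mO}(x), s^{mO}(x)²) with μ^{mO}(x) = x + T₁(g''(x),h) g'(x) − (h²/6) g''(x) g'(x) − (h²/24) g'''(x) and s^{mO}(x) = [T₁(g''(x),2h) − (h²/3) g''(x)]^{1/2}, where g = log π. Then Q is transient. -/
open MeasureTheory ProbabilityTheory Filter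
open scoped NNReal ENNReal Classical

/-- The class `ℰ(β,γ)`: positive `C³` probability densities on `ℝ` proportional to
`e^{-γ|x|^β}` outside a bounded interval. -/
def ClassE (β γ : ℝ) (π : ℝ → ℝ) : Prop :=
  (∀ x, 0 < π x) ∧ ContDiff ℝ 3 π ∧ (∫ x, π x = 1) ∧
    ∃ R c₀ : ℝ, 0 < R ∧ ∀ x : ℝ, R ≤ |x| → π x = c₀ * Real.exp (-γ * |x| ^ β)

/-- `T₁(t,h) = (e^{(h/2)t} − 1)/t`, extended by `h/2` at `t = 0`. -/
noncomputable def T1s (t h : ℝ) : ℝ :=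
  if t = 0 then h / 2 else (Real.exp (h / 2 * t) - 1) / t

/-- The mUOA proposal mean
`μ^{mO}(x) = x + T₁(g''(x),h)g'(x) − (h²/6)g''(x)g'(x) − (h²/24)g'''(x)`, `g = log π`. -/
noncomputable def muoaMu (π : ℝ → ℝ) (h x : ℝ) : ℝ :=
  x + T1s (iteratedDeriv 2 (fun y => Real.log (π y)) x) h *
      deriv (fun y => Real.log (π y)) x -
    (h ^ 2 / 6) * iteratedDeriv 2 (fun y => Real.log (π y)) x *
      deriv (fun y => Real.log (π y)) x -
    (h ^ 2 / 24) * iteratedDeriv 3 (fun y => Real.log (π y)) x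

/-- The mUOA proposal standard deviation
`s^{mO}(x) = [T₁(g''(x),2h) − (h²/3)g''(x)]^{1/2}`. -/
noncomputable def muoaS (π : ℝ → ℝ) (h x : ℝ) : ℝ :=
  Real.sqrt (T1s (iteratedDeriv 2 (fun y => Real.log (π y)) x) (2 * h) -
    (h ^ 2 / 3) * iteratedDeriv 2 (fun y => Real.log (π y)) x)

/-- Iterates of a Markov kernel: `kiter Q n = Qⁿ`. -/
noncomputable def kiter {α : Type*} [MeasurableSpace α] (Q : Kernel α α) : ℕ → Kernel α α
  | 0 => Kernel.id
  | n + 1 => (kiter Q n).comp Q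

/-- A Markov kernel `Q` is transient: the space is a countable union of uniformly
transient Borel sets. -/
def IsTransientKernel {α : Type*} [MeasurableSpace α] (Q : Kernel α α) : Prop :=
  ∃ A : ℕ → Set α, (∀ j, MeasurableSet (A j)) ∧ (⋃ j, A j) = Set.univ ∧
    ∀ j, ∃ B : ℝ≥0∞, B < ⊤ ∧ ∀ x, (∑' n : ℕ, kiter Q n x (A j)) ≤ B

theorem isTransientKernel_of_lintegral_lt {α : Type*} [MeasurableSpace α] (Q : Kernel α α)
    {V : α → ℝ≥0∞} (hV : Measurable V) (hV_le : ∀ x, V x ≤ 1)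
    (hdrift : ∀ x, ∫⁻ y, V y ∂(Q x) < V x) : IsTransientKernel Q := by
  have hmeas : Measurable fun x => ∫⁻ y, V y ∂(Q x) := hV.lintegral_kernel
  refine ⟨fun j => {x | ∫⁻ y, V y ∂(Q x) + ((j : ℝ≥0∞) + 1)⁻¹ ≤ V x}, fun j =>
    measurableSet_le (hmeas.add_const _) hV, ?_, fun j => ?_⟩
  · refine Set.eq_univ_of_forall fun x => Set.mem_iUnion.2 ?_
    obtain ⟨n, hn⟩ := ENNReal.exists_inv_nat_lt (tsub_pos_of_lt (hdrift x)).ne'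
    refine ⟨n, ?_⟩
    calc ∫⁻ y, V y ∂(Q x) + ((n : ℝ≥0∞) + 1)⁻¹
        ≤ ∫⁻ y, V y ∂(Q x) + (V x - ∫⁻ y, V y ∂(Q x)) := by
          gcongr
          exact (ENNReal.inv_le_inv.2 le_self_add).trans hn.le
      _ = V x := add_tsub_cancel_of_le (hdrift x).le
  · set A : Set α := {x | ∫⁻ y, V y ∂(Q x) + ((j : ℝ≥0∞) + 1)⁻¹ ≤ V x} with hA_def
    have hA : MeasurableSet A := measurableSet_le (hmeas.add_const _) hV
    have hj : ((j : ℝ≥0∞) + 1) ≠ 0 := by simp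
    have hj' : ((j : ℝ≥0∞) + 1) ≠ ⊤ := by simp
    have hsum : ∀ N x, ((j : ℝ≥0∞) + 1)⁻¹ * ∑ n ∈ Finset.range N, kiter Q n x A ≤ V x := by
      intro N
      induction N with
      | zero => simp
      | succ N ih =>
        intro x
        have hstep : ∑ n ∈ Finset.range N, kiter Q (n + 1) x A =
            ∫⁻ y, ∑ n ∈ Finset.range N, kiter Q n y A ∂(Q x) := by
          rw [lintegral_finsetSum _ fun n _ => Kernel.measurable_coe _ hA]
          exact Finset.sum_congr rfl fun n _ => Kernel.comp_apply' _ _ _ hA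
        have hint : ((j : ℝ≥0∞) + 1)⁻¹ * ∫⁻ y, ∑ n ∈ Finset.range N, kiter Q n y A ∂(Q x) ≤
            ∫⁻ y, V y ∂(Q x) := by
          rw [← lintegral_const_mul _
            (Finset.measurable_fun_sum _ fun n _ => Kernel.measurable_coe _ hA)]
          exact lintegral_mono ih
        rw [Finset.sum_range_succ', hstep, mul_add]
        by_cases hx : x ∈ A
        · refine le_trans ?_ (show ∫⁻ y, V y ∂(Q x) + ((j : ℝ≥0∞) + 1)⁻¹ ≤ V x from hx)
          gcongr
          simp [kiter, Kernel.id_apply, hA, hx]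
        · refine le_trans ?_ (hdrift x).le
          simpa [kiter, Kernel.id_apply, hA, hx] using hint
    refine ⟨(j : ℝ≥0∞) + 1, hj'.lt_top, fun x => ?_⟩
    rw [ENNReal.tsum_eq_iSup_nat]
    refine iSup_le fun N => ?_
    have := (hsum N x).trans (hV_le x)
    rwa [mul_comm, ← div_eq_mul_inv, ENNReal.div_le_iff hj hj', one_mul] at this

theorem T1s_two_mul_sub_pos {h : ℝ} (hh : 0 < h) (t : ℝ) :
    0 < T1s t (2 * h) - h ^ 2 / 3 * t := by
  unfold T1s
  split_ifs with ht
  · subst ht; simpa using hh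
  · rw [show 2 * h / 2 * t = h * t by ring]
    rcases lt_or_gt_of_ne ht with ht | ht
    · have h1 : Real.exp (h * t) < 1 := Real.exp_lt_one_iff.2 (mul_neg_of_pos_of_neg hh ht)
      have h2 : 0 < (Real.exp (h * t) - 1) / t := div_pos_of_neg_of_neg (by linarith) ht
      nlinarith [mul_pos (pow_pos hh 2) (neg_pos.2 ht)]
    · have h1 := Real.quadratic_le_exp_of_nonneg (mul_pos hh ht).le
      have h2 : h + h ^ 2 / 2 * t ≤ (Real.exp (h * t) - 1) / t := by
        rw [le_div_iff₀ ht]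
        nlinarith
      nlinarith [mul_pos (pow_pos hh 2) ht]

theorem T1s_neg_mem_Icc {h D : ℝ} (hh : 0 < h) (hD : 0 < D) :
    T1s (-D) h ∈ Set.Icc 0 D⁻¹ := by
  have h1 : T1s (-D) h = (1 - Real.exp (h / 2 * -D)) / D := by
    rw [T1s, if_neg (neg_ne_zero.2 hD.ne'), div_neg, ← neg_div, neg_sub]
  have h2 : Real.exp (h / 2 * -D) ≤ 1 := Real.exp_le_one_iff.2 (by nlinarith)
  have h3 := Real.exp_pos (h / 2 * -D)
  rw [h1, inv_eq_one_div]
  exact ⟨div_nonneg (by linarith) hD.le, by gcongr; linarith⟩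

/-- Derivatives of a function that agrees with `C - γ y ^ β` on a right half-line. -/
theorem derivs_of_eq_sub_mul_rpow {g : ℝ → ℝ} {R C γ β x : ℝ} (hR : 0 < R)
    (hg : ∀ y, R ≤ y → g y = C - γ * y ^ β) (hx : R < x) :
    deriv g x = -(γ * β * x ^ (β - 1)) ∧
      iteratedDeriv 2 g x = -((β - 1) * (γ * β * x ^ (β - 1)) / x) ∧
      iteratedDeriv 3 g x = -((β - 2) * ((β - 1) * (γ * β * x ^ (β - 1)) / x) / x) := by
  have hmem : ∀ y, R < y → ∀ᶠ z in nhds y, R < z := fun y hy => lt_mem_nhds hy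
  have hpow : ∀ (p y : ℝ), R < y → HasDerivAt (fun z : ℝ => z ^ p) (p * y ^ (p - 1)) y :=
    fun p y hy => Real.hasDerivAt_rpow_const (Or.inl (hR.trans hy).ne')
  have h1 : ∀ y, R < y → deriv g y = -(γ * β * y ^ (β - 1)) := by
    intro y hy
    have heq : g =ᶠ[nhds y] fun z => C - γ * z ^ β := by
      filter_upwards [hmem y hy] with z hz using hg z hz.le
    rw [heq.deriv_eq, (((hpow β y hy).const_mul γ).const_sub C).deriv]
    ring
  have h2 : ∀ y, R < y → iteratedDeriv 2 g y = -(γ * β * (β - 1) * y ^ (β - 2)) := by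
    intro y hy
    have heq : deriv g =ᶠ[nhds y] fun z => -(γ * β * z ^ (β - 1)) := by
      filter_upwards [hmem y hy] with z hz using h1 z hz
    rw [iteratedDeriv_succ, iteratedDeriv_one, heq.deriv_eq,
      ((hpow (β - 1) y hy).const_mul (γ * β)).fun_neg.deriv, show β - 1 - 1 = β - 2 by ring]
    ring
  have h3 : iteratedDeriv 3 g x = -(γ * β * (β - 1) * (β - 2) * x ^ (β - 3)) := by
    have heq : iteratedDeriv 2 g =ᶠ[nhds x] fun z => -(γ * β * (β - 1) * z ^ (β - 2)) := by
      filter_upwards [hmem x hx] with z hz using h2 z hz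
    rw [iteratedDeriv_succ, heq.deriv_eq,
      ((hpow (β - 2) x hx).const_mul (γ * β * (β - 1))).fun_neg.deriv,
      show β - 2 - 1 = β - 3 by ring]
    ring
  have hx0 : 0 < x := hR.trans hx
  have e2 : x ^ (β - 2) = x ^ (β - 1) / x := by
    rw [← Real.rpow_sub_one hx0.ne']; ring_nf
  have e3 : x ^ (β - 3) = x ^ (β - 1) / x / x := by
    rw [← e2, ← Real.rpow_sub_one hx0.ne']; ring_nf
  refine ⟨h1 x hx, ?_, ?_⟩
  · rw [h2 x hx, e2]; ring
  · rw [h3, e3]; ring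

/-- Derivatives of a function that agrees with `C - γ |y| ^ β` outside a bounded interval; the
sign of `x` enters through `σ`. -/
theorem derivs_of_eq_sub_mul_abs_rpow {g : ℝ → ℝ} {R C γ β x : ℝ} (hR : 0 < R)
    (hg : ∀ y, R ≤ |y| → g y = C - γ * |y| ^ β) (hx : R < |x|) :
    ∃ σ : ℝ, |σ| = 1 ∧ x = σ * |x| ∧
      deriv g x = -(σ * (γ * β * |x| ^ (β - 1))) ∧
      iteratedDeriv 2 g x = -((β - 1) * (γ * β * |x| ^ (β - 1)) / |x|) ∧
      iteratedDeriv 3 g x =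
        -(σ * ((β - 2) * ((β - 1) * (γ * β * |x| ^ (β - 1)) / |x|) / |x|)) := by
  rcases le_total 0 x with h0 | h0
  · rw [abs_of_nonneg h0] at hx ⊢
    obtain ⟨h1, h2, h3⟩ := derivs_of_eq_sub_mul_rpow (g := g) (C := C) (γ := γ) (β := β)
      hR (fun y hy => by
      rw [hg y (hy.trans (le_abs_self y)), abs_of_nonneg (hR.le.trans hy)]) hx
    exact ⟨1, by simp, by simp, by rw [h1, one_mul], h2, by rw [h3, one_mul]⟩
  · rw [abs_of_nonpos h0] at hx ⊢
    obtain ⟨h1, h2, h3⟩ := derivs_of_eq_sub_mul_rpow (g := fun y => g (-y)) (C := C) (γ := γ) (β := β)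
      hR (fun y hy => by
      rw [hg (-y) (by rw [abs_neg]; exact hy.trans (le_abs_self y)), abs_neg,
        abs_of_nonneg (hR.le.trans hy)]) hx
    rw [deriv_comp_neg, neg_neg] at h1
    rw [iteratedDeriv_comp_neg, neg_neg] at h2 h3
    refine ⟨-1, by simp, by simp, ?_, ?_, ?_⟩
    · linarith
    · rw [← h2]; simp
    · rw [neg_one_mul, ← h3, smul_eq_mul]; ring

theorem mean_and_variance_bounds {h β a E D F T T' : ℝ} (hh : 0 < h) (hβ : 2 < β) (ha : 1 ≤ a)
    {K : ℝ} (hK : 1 ≤ K) (hKβ : β ≤ K) (hKh : 7 ≤ K * h) (hE : K * a ≤ E)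
    (hD : D = (β - 1) * E / a) (hF : F = (β - 2) * D / a)
    (hT : T ∈ Set.Icc 0 D⁻¹) (hT' : T' ≤ D⁻¹) :
    4 * a ≤ |a - T * E + -(h ^ 2 / 6 * D * E) + h ^ 2 / 24 * F| ∧
      (T' + h ^ 2 / 3 * D) * (h * a) ^ 2 ≤
        576 * (|a - T * E + -(h ^ 2 / 6 * D * E) + h ^ 2 / 24 * F| / 2) ^ 2 := by
  have ha0 : 0 < a := by linarith
  have hE0 : 0 < E := by nlinarith
  have hEa : a ≤ E := by nlinarith
  have hDK : K ≤ D := by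
    rw [hD, le_div_iff₀ ha0]
    nlinarith
  have hD0 : 0 < D := by linarith
  have hFE : F ≤ D * E := by
    rw [hF, div_le_iff₀ ha0]
    have : β - 2 ≤ E * a := by nlinarith
    nlinarith
  have hDE : K ^ 2 * a ≤ D * E := by nlinarith
  have hKh2 : 49 ≤ h ^ 2 * K ^ 2 := by nlinarith
  have hbig : 49 * a ≤ h ^ 2 * (D * E) := by
    calc 49 * a ≤ h ^ 2 * K ^ 2 * a := by gcongr
      _ = h ^ 2 * (K ^ 2 * a) := by ring
      _ ≤ _ := by gcongr
  have hTE : 0 ≤ T * E := mul_nonneg hT.1 hE0.le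
  have hhF : h ^ 2 * F ≤ h ^ 2 * (D * E) := by gcongr
  have hlow : h ^ 2 / 12 * (D * E) ≤
      |a - T * E + -(h ^ 2 / 6 * D * E) + h ^ 2 / 24 * F| := by
    refine le_trans ?_ (neg_le_abs _)
    nlinarith
  refine ⟨by nlinarith, ?_⟩
  have hDinv : D⁻¹ ≤ h ^ 2 / 3 * D := by
    rw [inv_le_iff_one_le_mul₀ hD0]
    have : K ^ 2 ≤ D ^ 2 := by gcongr
    nlinarith [mul_le_mul_of_nonneg_left this (sq_nonneg h)]
  have hv : T' + h ^ 2 / 3 * D ≤ h ^ 2 * D := by nlinarith [mul_pos (pow_pos hh 2) hD0]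
  calc (T' + h ^ 2 / 3 * D) * (h * a) ^ 2 ≤ (h ^ 2 * D) * (h * a) ^ 2 := by gcongr
    _ = h ^ 4 * (D * 1 * a ^ 2) := by ring
    _ ≤ h ^ 4 * (D * D * E ^ 2) := by gcongr; linarith
    _ = 576 * (h ^ 2 / 12 * (D * E) / 2) ^ 2 := by ring
    _ ≤ _ := by gcongr

/-- Far from the origin the mUOA mean is large compared with both the current state and the
proposal standard deviation. -/
theorem muoa_tail_bounds {γ β : ℝ} (hγ : 0 < γ) (hβ : 2 < β) {π : ℝ → ℝ} (hπ : ClassE β γ π)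
    {h : ℝ} (hh : 0 < h) :
    ∃ r : ℝ, ∀ x, r ≤ |x| → 4 * |x| ≤ |muoaMu π h x| ∧
      muoaS π h x ^ 2 * (h * |x|) ^ 2 ≤ 576 * (|muoaMu π h x| / 2) ^ 2 := by
  obtain ⟨hpos, -, -, R, c₀, hR, htail⟩ := hπ
  have hc₀ : 0 < c₀ := by
    have h1 := hpos R
    rw [htail R (le_abs_self R)] at h1
    exact pos_of_mul_pos_left h1 (Real.exp_pos _).le
  have hg : ∀ y, R ≤ |y| → Real.log (π y) = Real.log c₀ - γ * |y| ^ β := fun y hy => by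
    rw [htail y hy, Real.log_mul hc₀.ne' (Real.exp_pos _).ne', Real.log_exp]; ring
  set K : ℝ := max 1 (max β (7 / h))
  have hK1 : 1 ≤ K := le_max_left _ _
  have hKβ : β ≤ K := (le_max_left _ _).trans (le_max_right _ _)
  have hKh : 7 ≤ K * h :=
    (div_le_iff₀ hh).1 ((le_max_right β (7 / h)).trans (le_max_right _ _))
  obtain ⟨r, hr⟩ := eventually_atTop.1 ((tendsto_rpow_atTop (show 0 < β - 2 by linarith)).eventually
    (eventually_ge_atTop (K / (γ * β))))
  refine ⟨max r (max 1 (R + 1)), fun x hx => ?_⟩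
  have hxr : r ≤ |x| := (le_max_left _ _).trans hx
  have hx1 : 1 ≤ |x| := (le_max_left _ _).trans ((le_max_right _ _).trans hx)
  have hxR : R < |x| := by
    linarith [(le_max_right 1 (R + 1)).trans ((le_max_right r _).trans hx)]
  have hx0 : 0 < |x| := by linarith
  have hγβ : 0 < γ * β := mul_pos hγ (by linarith)
  have hE : K * |x| ≤ γ * β * |x| ^ (β - 1) := by
    have h1 := (div_le_iff₀' hγβ).1 (hr _ hxr)
    have h2 : |x| ^ (β - 1) = |x| ^ (β - 2) * |x| := by
      rw [← Real.rpow_add_one hx0.ne']; ring_nf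
    rw [h2, ← mul_assoc]
    gcongr
  obtain ⟨σ, hσ, hxσ, h1, h2, h3⟩ := derivs_of_eq_sub_mul_abs_rpow hR hg hxR
  set E : ℝ := γ * β * |x| ^ (β - 1) with hE_def
  set D : ℝ := (β - 1) * E / |x| with hD_def
  have hE0 : 0 < E := by nlinarith
  have hD0 : 0 < D := div_pos (mul_pos (by linarith) hE0) hx0
  have hμ : |muoaMu π h x| = |(|x| - T1s (-D) h * E + -(h ^ 2 / 6 * D * E) +
      h ^ 2 / 24 * ((β - 2) * D / |x|))| := by
    rw [muoaMu, h1, h2, h3, ← one_mul |(|x| - _ + _ + _)|, ← hσ, ← abs_mul]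
    congr 1
    nth_rewrite 1 [hxσ]
    ring
  have hS : muoaS π h x ^ 2 = T1s (-D) (2 * h) + h ^ 2 / 3 * D := by
    rw [muoaS, Real.sq_sqrt (T1s_two_mul_sub_pos hh _).le, h2]
    ring
  rw [hμ, hS]
  exact mean_and_variance_bounds hh hβ hx1 hK1 hKβ hKh hE hD_def rfl
    (T1s_neg_mem_Icc hh hD0) (T1s_neg_mem_Icc (by linarith) hD0).2

theorem gaussianReal_abs_lt_le {m : ℝ} {v : ℝ≥0} {b : ℝ} (hm : 0 < |m|) (hb : b ≤ |m| / 2) :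
    gaussianReal m v {y | |y| < b} ≤ ENNReal.ofReal (v / (|m| / 2) ^ 2) := by
  have h1 := meas_ge_le_variance_div_sq (memLp_id_gaussianReal (μ := m) (v := v) 2)
    (half_pos hm)
  simp only [id_eq, integral_id_gaussianReal, variance_id_gaussianReal] at h1
  refine (measure_mono fun y hy => ?_).trans h1
  have h2 : |m| - |y| ≤ |y - m| := by
    rw [abs_sub_comm]; exact abs_sub_abs_le_abs_sub m y
  have h3 : |y| < b := hy
  show |m| / 2 ≤ |y - m|
  linarith

theorem muoa_transient (γ β : ℝ) (hγ : 0 < γ) (hβ : 2 < β)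
    (π : ℝ → ℝ) (hπ : ClassE β γ π) (h : ℝ) (hh : 0 < h)
    (Q : Kernel ℝ ℝ)
    (hQ : ∀ x, Q x = gaussianReal (muoaMu π h x) (Real.toNNReal ((muoaS π h x) ^ 2))) :
    IsTransientKernel Q := by
  obtain ⟨r₀, hr₀⟩ := muoa_tail_bounds hγ hβ hπ hh
  set r : ℝ := max r₀ (max 1 (1153 / h ^ 2))
  have hr1 : 1 ≤ r := (le_max_left _ _).trans (le_max_right _ _)
  have hrh : 1153 ≤ r * h ^ 2 :=
    (div_le_iff₀ (by positivity)).1 ((le_max_right _ _).trans (le_max_right r₀ _))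
  have hr0 : 0 < r := by linarith
  have hV_meas : Measurable fun x : ℝ => ENNReal.ofReal (r / max r |x|) := by fun_prop
  have hV_le : ∀ x : ℝ, ENNReal.ofReal (r / max r |x|) ≤ 1 := fun x =>
    ENNReal.ofReal_le_one.2 (div_le_one_of_le₀ (le_max_left _ _) (hr0.le.trans (le_max_left _ _)))
  refine isTransientKernel_of_lintegral_lt Q hV_meas hV_le fun x => ?_
  have hS : 0 < muoaS π h x ^ 2 := by
    rw [muoaS, Real.sq_sqrt (T1s_two_mul_sub_pos hh _).le]
    exact T1s_two_mul_sub_pos hh _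
  rw [hQ x]
  rcases lt_or_ge |x| r with hx | hx
  · rw [max_eq_left hx.le, div_self hr0.ne', ENNReal.ofReal_one]
    have hv : Real.toNNReal (muoaS π h x ^ 2) ≠ 0 := (Real.toNNReal_pos.2 hS).ne'
    set P := gaussianReal (muoaMu π h x) (Real.toNNReal (muoaS π h x ^ 2))
    have hP : P (Set.Ioi r) ≠ 0 := fun h0 => by
      simpa using gaussianReal_absolutelyContinuous' (muoaMu π h x) hv h0
    have hlt := lintegral_strict_mono_of_ae_le_of_ae_lt_on (μ := P)
      (f := fun y => ENNReal.ofReal (r / max r |y|)) (g := fun _ => 1) aemeasurable_const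
      (by
        refine ((lintegral_mono hV_le).trans_lt ?_).ne
        simp) (ae_of_all _ hV_le) hP (ae_of_all _ fun y hy => by
        have hy' : r < |y| := (Set.mem_Ioi.1 hy).trans_le (le_abs_self y)
        rw [max_eq_right hy'.le, ENNReal.ofReal_lt_one]
        exact (div_lt_one (hr0.trans hy')).2 hy')
    simpa using hlt
  · obtain ⟨hμ, hvar⟩ := hr₀ x ((le_max_left _ _).trans hx)
    have hx0 : 0 < |x| := hr0.trans_le hx
    have hμ0 : 0 < |muoaMu π h x| := by linarith
    have hP := gaussianReal_abs_lt_le (v := Real.toNNReal (muoaS π h x ^ 2)) hμ0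
      (show 2 * |x| ≤ |muoaMu π h x| / 2 by linarith)
    rw [Real.coe_toNNReal _ hS.le] at hP
    set P := gaussianReal (muoaMu π h x) (Real.toNNReal (muoaS π h x ^ 2))
    have hA : MeasurableSet {y : ℝ | |y| < 2 * |x|} :=
      measurableSet_lt measurable_norm measurable_const
    have hle : ∀ y : ℝ, ENNReal.ofReal (r / max r |y|) ≤
        ENNReal.ofReal (r / (2 * |x|)) + {y : ℝ | |y| < 2 * |x|}.indicator 1 y := fun y => by
      by_cases hy : |y| < 2 * |x|
      · rw [Set.indicator_of_mem (by exact hy)]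
        exact (hV_le y).trans le_add_self
      · refine le_trans (ENNReal.ofReal_le_ofReal ?_) le_self_add
        gcongr
        exact (not_lt.1 hy).trans (le_max_right _ _)
    have hratio : muoaS π h x ^ 2 / (|muoaMu π h x| / 2) ^ 2 < r / (2 * |x|) := by
      rw [div_lt_div_iff₀ (by positivity) (by positivity)]
      set w := (|muoaMu π h x| / 2) ^ 2
      have hw : 0 < w := by positivity
      refine lt_of_mul_lt_mul_right (a := h ^ 2 * |x|) ?_ (by positivity)
      have hrx : 1153 ≤ r * h ^ 2 * |x| := by nlinarith
      nlinarith [mul_le_mul_of_nonneg_right hrx hw.le]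
    calc ∫⁻ y, ENNReal.ofReal (r / max r |y|) ∂P
        ≤ ∫⁻ y, (ENNReal.ofReal (r / (2 * |x|)) + {y : ℝ | |y| < 2 * |x|}.indicator 1 y) ∂P :=
          lintegral_mono hle
      _ = ENNReal.ofReal (r / (2 * |x|)) + P {y : ℝ | |y| < 2 * |x|} := by
          rw [lintegral_add_left measurable_const, lintegral_indicator_one hA]
          simp
      _ ≤ ENNReal.ofReal (r / (2 * |x|)) +
          ENNReal.ofReal (muoaS π h x ^ 2 / (|muoaMu π h x| / 2) ^ 2) := by gcongr
      _ = ENNReal.ofReal (r / (2 * |x|) + muoaS π h x ^ 2 / (|muoaMu π h x| / 2) ^ 2) :=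
          (ENNReal.ofReal_add (by positivity) (by positivity)).symm
      _ < ENNReal.ofReal (r / max r |x|) := by
          rw [max_eq_right hx]
          refine (ENNReal.ofReal_lt_ofReal_iff (by positivity)).2 ?_
          have : r / |x| = r / (2 * |x|) + r / (2 * |x|) := by field_simp; norm_num
          linarith
end

section
/- Let γ > 0, β > 2 and let π be a positive C³ probability density on ℝ belonging to the class ℰ(β,γ). Fix h > 0 and let Q be the Markov kernel on ℝ of the unadjusted scheme bUOA, namely Q(x,·) = N(μ^{bO}(x), s^{bO}(x)²) with μ^{bO}(x) = x + T₁(g''(x),h) g'(x) + (2/3) T₂(g''(x),h) g'(x) − (1/3) T₃(g''(x),h) g'''(x) and s^{bO}(x) = [T₁(g''(x),2h) + (1/3) T₂(g''(x),2h)]^{1/2}, where g = log π. Then Q is geometrically ergodic. -/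
open MeasureTheory ProbabilityTheory Filter
open scoped NNReal ENNReal Classical

/-- `T₂(t,h) = (e^{-(h²/4)t²} − 1)/t`, extended by `0` at `t = 0`. -/
noncomputable def T2s (t h : ℝ) : ℝ :=
  if t = 0 then 0 else (Real.exp (-(h ^ 2 / 4) * t ^ 2) - 1) / t

/-- `T₃(t,h) = (e^{(h/2)t} − 1 − (h/2)t)/t²`, extended by `h²/8` at `t = 0`. -/
noncomputable def T3s (t h : ℝ) : ℝ :=
  if t = 0 then h ^ 2 / 8 else (Real.exp (h / 2 * t) - 1 - h / 2 * t) / t ^ 2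

/-- The bUOA proposal mean
`μ^{bO}(x) = x + T₁(g'',h)g' + (2/3)T₂(g'',h)g' − (1/3)T₃(g'',h)g'''`, `g = log π`. -/
noncomputable def buoaMu (π : ℝ → ℝ) (h x : ℝ) : ℝ :=
  x + T1s (iteratedDeriv 2 (fun y => Real.log (π y)) x) h *
      deriv (fun y => Real.log (π y)) x +
    (2 / 3) * T2s (iteratedDeriv 2 (fun y => Real.log (π y)) x) h *
      deriv (fun y => Real.log (π y)) x -
    (1 / 3) * T3s (iteratedDeriv 2 (fun y => Real.log (π y)) x) h *
      iteratedDeriv 3 (fun y => Real.log (π y)) x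

/-- The bUOA proposal standard deviation
`s^{bO}(x) = [T₁(g''(x),2h) + (1/3)T₂(g''(x),2h)]^{1/2}`. -/
noncomputable def buoaS (π : ℝ → ℝ) (h x : ℝ) : ℝ :=
  Real.sqrt (T1s (iteratedDeriv 2 (fun y => Real.log (π y)) x) (2 * h) +
    (1 / 3) * T2s (iteratedDeriv 2 (fun y => Real.log (π y)) x) (2 * h))

/-- The `V`-norm `‖μ - ν‖_V = ∫ V d|μ - ν|` of the difference of two finite measures
(set to `0` in the degenerate case where one of the measures is not finite). -/
noncomputable def vNorm {α : Type*} [MeasurableSpace α] (μ ν : Measure α) (V : α → ℝ) :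
    ℝ≥0∞ :=
  if h : IsFiniteMeasure μ ∧ IsFiniteMeasure ν then
    ∫⁻ y, ENNReal.ofReal (V y)
      ∂((@Measure.toSignedMeasure α _ μ h.1 - @Measure.toSignedMeasure α _ ν h.2).totalVariation)
  else 0

/-- A Markov kernel `Q` is geometrically ergodic: for some invariant probability measure
`ν` and some measurable `V ≥ 1`, `‖Qⁿ(x,·) − ν‖_V ≤ C ρⁿ V(x)` with `ρ < 1`. -/
def IsGeomErgodic {α : Type*} [MeasurableSpace α] (Q : Kernel α α) : Prop :=
  ∃ ν : Measure α, IsProbabilityMeasure ν ∧ ν.bind (fun x => Q x) = ν ∧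
    ∃ V : α → ℝ, Measurable V ∧ (∀ x, 1 ≤ V x) ∧
      ∃ C : ℝ, 0 ≤ C ∧ ∃ ρ : ℝ, ρ ∈ Set.Ico (0 : ℝ) 1 ∧
        ∀ x n, vNorm (kiter Q n x) ν V ≤ ENNReal.ofReal (C * ρ ^ n * V x)

section Iterates

variable {α : Type*} [MeasurableSpace α] {Q : Kernel α α}

instance isMarkovKernel_kiter [IsMarkovKernel Q] (n : ℕ) : IsMarkovKernel (kiter Q n) := by
  induction n with
  | zero => unfold kiter; infer_instance
  | succ n ih => unfold kiter; infer_instance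

lemma kiter_succ' (n : ℕ) : kiter Q (n + 1) = Q.comp (kiter Q n) := by
  induction n with
  | zero => simp [kiter]
  | succ n ih =>
    calc kiter Q (n + 1 + 1) = (kiter Q (n + 1)).comp Q := rfl
      _ = Q.comp (kiter Q (n + 1)) := by
        conv_lhs => rw [ih, Kernel.comp_assoc]
        rfl

/-- Iterated Foster–Lyapunov drift bound. -/
lemma lintegral_kiter_le {V : α → ℝ} (hVm : Measurable V) (hV0 : ∀ x, 0 ≤ V x)
    [IsMarkovKernel Q] {l K : ℝ} (hl0 : 0 ≤ l) (hl1 : l < 1) (hK : 0 ≤ K)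
    (hdrift : ∀ x, ∫⁻ y, ENNReal.ofReal (V y) ∂(Q x) ≤ ENNReal.ofReal (l * V x + K))
    (n : ℕ) (x : α) :
    ∫⁻ y, ENNReal.ofReal (V y) ∂(kiter Q n x)
      ≤ ENNReal.ofReal (l ^ n * V x + K / (1 - l) * (1 - l ^ n)) := by
  induction n generalizing x with
  | zero =>
    simp only [kiter, Kernel.id_apply, pow_zero, one_mul, sub_self, mul_zero, add_zero]
    rw [lintegral_dirac' _ hVm.ennreal_ofReal]
  | succ n ih =>
    have h1 : (0 : ℝ) < 1 - l := by linarith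
    have hpow : 0 ≤ 1 - l ^ n := by linarith [pow_le_one₀ (n := n) hl0 hl1.le]
    have hc : 0 ≤ K / (1 - l) * (1 - l ^ n) := by positivity
    have hpn : 0 ≤ l ^ n := by positivity
    calc ∫⁻ y, ENNReal.ofReal (V y) ∂(kiter Q (n + 1) x)
        = ∫⁻ z, ∫⁻ y, ENNReal.ofReal (V y) ∂(kiter Q n z) ∂(Q x) :=
          Kernel.lintegral_comp _ _ _ hVm.ennreal_ofReal
      _ ≤ ∫⁻ z, (ENNReal.ofReal (l ^ n) * ENNReal.ofReal (V z)
            + ENNReal.ofReal (K / (1 - l) * (1 - l ^ n))) ∂(Q x) := by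
          refine lintegral_mono fun z => (ih z).trans ?_
          rw [← ENNReal.ofReal_mul hpn, ← ENNReal.ofReal_add (mul_nonneg hpn (hV0 z)) hc]
      _ = ENNReal.ofReal (l ^ n) * ∫⁻ z, ENNReal.ofReal (V z) ∂(Q x)
            + ENNReal.ofReal (K / (1 - l) * (1 - l ^ n)) := by
          rw [lintegral_add_right _ measurable_const,
            lintegral_const_mul _ hVm.ennreal_ofReal]
          simp
      _ ≤ ENNReal.ofReal (l ^ n) * ENNReal.ofReal (l * V x + K)
            + ENNReal.ofReal (K / (1 - l) * (1 - l ^ n)) := by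
          gcongr
          exact hdrift x
      _ = _ := by
          have : 0 ≤ l * V x + K := by have := hV0 x; positivity
          rw [← ENNReal.ofReal_mul hpn, ← ENNReal.ofReal_add (by positivity) hc]
          congr 1
          field_simp
          ring

end Iterates

section WeightedContraction

/-- A function whose oscillation is controlled by `w` lies within `w` of a constant. -/
lemma exists_abs_sub_le_of_sub_le {α : Type*} [Nonempty α] {f w : α → ℝ}
    (hf : ∀ x y, f x - f y ≤ w x + w y) : ∃ c, ∀ x, |f x - c| ≤ w x := by
  have hbdd : BddAbove (Set.range fun x => f x - w x) := by
    obtain ⟨y⟩ := ‹Nonempty α›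
    refine ⟨f y + w y, ?_⟩
    rintro _ ⟨x, rfl⟩
    dsimp only
    linarith [hf x y]
  refine ⟨⨆ x, (f x - w x), fun x => ?_⟩
  have h1 : f x - w x ≤ ⨆ x, (f x - w x) := le_ciSup hbdd x
  have h2 : ⨆ x, (f x - w x) ≤ f x + w x := ciSup_le fun y => by linarith [hf y x]
  rw [abs_le]
  constructor <;> linarith

/-- One step of a kernel satisfying a drift and a minorization condition contracts the
oscillation seminorm weighted by `1 + b V`. -/
lemma exists_weighted_contraction {α : Type*} [MeasurableSpace α] [Nonempty α]
    {Q : Kernel α α} [IsMarkovKernel Q]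
    {V : α → ℝ} (hV0 : ∀ x, 0 ≤ V x) (hVi : ∀ x, Integrable V (Q x))
    {l K : ℝ} (hl0 : 0 ≤ l) (hl1 : l < 1) (hK : 0 ≤ K)
    (hdrift : ∀ x, ∫ y, V y ∂(Q x) ≤ l * V x + K)
    {R : ℝ} (hR : 2 * K < (1 - l) * R)
    {m : Measure α} [IsProbabilityMeasure m] {ε : ℝ} (hε : 0 < ε)
    (hminor : ∀ x, V x ≤ R → ENNReal.ofReal ε • m ≤ Q x) :
    ∃ b ρ : ℝ, 0 < b ∧ 0 ≤ ρ ∧ ρ < 1 ∧ ∀ (φ : α → ℝ) (L c : ℝ), Measurable φ → 0 ≤ L →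
      (∀ x, |φ x - c| ≤ L * (1 + b * V x)) →
        ∃ c', ∀ x, |∫ y, φ y ∂(Q x) - c'| ≤ ρ * L * (1 + b * V x) := by
  set b : ℝ := ε / (2 * (K + 1)) with hb
  have hbpos : 0 < b := by positivity
  have hbK : 2 * b * K ≤ ε := by
    rw [hb]; field_simp; nlinarith
  have hR0 : 0 < R := by
    by_contra hcon
    nlinarith
  set ρ₀ : ℝ := (2 + 2 * b * K + b * l * R) / (2 + b * R) with hρ₀
  have hden : 0 < 2 + b * R := by positivity
  have hρ₀1 : ρ₀ < 1 := by
    rw [hρ₀, div_lt_one hden]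
    nlinarith
  set ρ : ℝ := max (max l (1 - ε / 2)) ρ₀ with hρ
  have hρl : l ≤ ρ := (le_max_left _ _).trans (le_max_left _ _)
  have hρε : 1 - ε / 2 ≤ ρ := (le_max_right _ _).trans (le_max_left _ _)
  have hρρ : ρ₀ ≤ ρ := le_max_right _ _
  have hρρ' : 2 + 2 * b * K + b * l * R ≤ ρ * (2 + b * R) := by
    rwa [hρ₀, div_le_iff₀ hden] at hρρ
  refine ⟨b, ρ, hbpos, hl0.trans hρl, ?_, ?_⟩
  · exact max_lt (max_lt hl1 (by linarith)) hρ₀1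
  intro φ L c hφm hL hφ
  have hwi : ∀ x, Integrable (fun y => L * (1 + b * V y)) (Q x) := fun x =>
    ((integrable_const _).add ((hVi x).const_mul b)).const_mul L
  have hψi : ∀ x, Integrable (fun y => φ y - c) (Q x) := fun x =>
    (hwi x).mono' (hφm.sub_const c).aestronglyMeasurable (ae_of_all _ hφ)
  have hφint : ∀ x, ∫ y, φ y ∂(Q x) = ∫ y, (φ y - c) ∂(Q x) + c := fun x => by
    have h1 : Integrable φ (Q x) := by
      refine ((hψi x).add (integrable_const c)).congr (ae_of_all _ fun y => ?_)
      simp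
    rw [integral_sub h1 (integrable_const c)]
    simp
  have hwint : ∀ x, ∫ y, L * (1 + b * V y) ∂(Q x) ≤ L * (1 + b * (l * V x + K)) := fun x => by
    rw [integral_const_mul, integral_add (integrable_const _) ((hVi x).const_mul b),
      integral_const_mul]
    simp only [integral_const, probReal_univ, one_smul]
    have := hdrift x
    gcongr
  apply exists_abs_sub_le_of_sub_le
  intro x y
  rw [hφint x, hφint y]
  by_cases hxy : V x ≤ R ∧ V y ≤ R
  · have key : ∀ z, V z ≤ R → ∀ f : α → ℝ, (∀ u, 0 ≤ f u) → Integrable f (Q z) →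
        Integrable f m ∧ ε * ∫ u, f u ∂m ≤ ∫ u, f u ∂(Q z) := by
      intro z hz f hf0 hfi
      have h1 : Integrable f (ENNReal.ofReal ε • m) := hfi.mono_measure (hminor z hz)
      refine ⟨?_, ?_⟩
      · rwa [integrable_smul_measure (by simpa using hε) (by simp)] at h1
      · have h2 := integral_mono_measure (hminor z hz) (ae_of_all _ hf0) hfi
        rwa [integral_smul_measure, ENNReal.toReal_ofReal hε.le, smul_eq_mul] at h2
    obtain ⟨hmi₁, hm₁⟩ := key x hxy.1 (fun u => L * (1 + b * V u) - (φ u - c))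
      (fun u => by linarith [le_abs_self (φ u - c), hφ u]) ((hwi x).sub (hψi x))
    obtain ⟨hmi₂, hm₂⟩ := key y hxy.2 (fun u => L * (1 + b * V u) + (φ u - c))
      (fun u => by linarith [neg_abs_le (φ u - c), hφ u]) ((hwi y).add (hψi y))
    have hsum : 2 * L ≤ ∫ u, (L * (1 + b * V u) - (φ u - c)) ∂m
        + ∫ u, (L * (1 + b * V u) + (φ u - c)) ∂m := by
      rw [← integral_add hmi₁ hmi₂]
      calc 2 * L = ∫ _, 2 * L ∂m := by simp
        _ ≤ _ := by
          refine integral_mono (integrable_const _) (hmi₁.add hmi₂) fun u => ?_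
          have := mul_nonneg (mul_nonneg hL hbpos.le) (hV0 u)
          dsimp only
          linarith
    rw [integral_sub (hwi x) (hψi x)] at hm₁
    rw [integral_add (hwi y) (hψi y)] at hm₂
    have hcontr : 2 - 2 * ε + 2 * b * K + b * l * (V x + V y) ≤ ρ * (2 + b * (V x + V y)) := by
      have : l * (b * (V x + V y)) ≤ ρ * (b * (V x + V y)) :=
        mul_le_mul_of_nonneg_right hρl (mul_nonneg hbpos.le (add_nonneg (hV0 x) (hV0 y)))
      linarith
    have hεsum := mul_le_mul_of_nonneg_left hsum hε.le
    have hLc := mul_le_mul_of_nonneg_left hcontr hL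
    linarith [hwint x, hwint y]
  · have hS : R ≤ V x + V y := by
      by_contra hcon
      exact hxy ⟨by linarith [hV0 y], by linarith [hV0 x]⟩
    have hA : ∫ u, (φ u - c) ∂(Q x) ≤ ∫ u, L * (1 + b * V u) ∂(Q x) :=
      integral_mono (hψi x) (hwi x) fun u => (le_abs_self _).trans (hφ u)
    have hB : -∫ u, (φ u - c) ∂(Q y) ≤ ∫ u, L * (1 + b * V u) ∂(Q y) := by
      rw [← integral_neg]
      exact integral_mono (hψi y).neg (hwi y) fun u => (neg_le_abs _).trans (hφ u)
    have hcontr : 2 + 2 * b * K + b * l * (V x + V y) ≤ ρ * (2 + b * (V x + V y)) := by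
      have : (ρ - l) * b * R ≤ (ρ - l) * b * (V x + V y) :=
        mul_le_mul_of_nonneg_left hS (mul_nonneg (by linarith) hbpos.le)
      linarith
    have hLc := mul_le_mul_of_nonneg_left hcontr hL
    linarith [hwint x, hwint y]

end WeightedContraction

section SetwiseLimits

variable {α : Type*} [MeasurableSpace α]

/-- A sequence of probability measures that is geometrically Cauchy, uniformly over measurable
sets, converges setwise to a probability measure. -/
lemma exists_setwise_limit {ν : ℕ → Measure α} [∀ n, IsProbabilityMeasure (ν n)] {C r : ℝ}
    (hr0 : 0 ≤ r) (hr1 : r < 1)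
    (hcauchy : ∀ n A, MeasurableSet A → dist ((ν n).real A) ((ν (n + 1)).real A) ≤ C * r ^ n) :
    ∃ μ : Measure α, IsProbabilityMeasure μ ∧
      ∀ A, MeasurableSet A → Tendsto (fun n => ν n A) atTop (nhds (μ A)) := by
  have hlim : ∀ A, ∃ a : ℝ,
      if MeasurableSet A then Tendsto (fun n => (ν n).real A) atTop (nhds a) else a = 0 := by
    intro A
    by_cases hA : MeasurableSet A
    · simp only [hA, if_true]
      exact cauchySeq_tendsto_of_complete
        (cauchySeq_of_le_geometric r C hr1 fun n => hcauchy n A hA)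
    · simp [hA]
  choose a ha using hlim
  have hat : ∀ A, MeasurableSet A → Tendsto (fun n => (ν n).real A) atTop (nhds (a A)) := by
    intro A hA
    simpa [hA] using ha A
  have ha0 : ∀ A, 0 ≤ a A := by
    intro A
    by_cases hA : MeasurableSet A
    · exact ge_of_tendsto' (hat A hA) fun n => measureReal_nonneg
    · have := ha A
      simp only [hA, if_false] at this
      exact this.ge
  have hunif : ∀ n A, MeasurableSet A → dist ((ν n).real A) (a A) ≤ C * r ^ n / (1 - r) :=
    fun n A hA => dist_le_of_le_geometric_of_tendsto r C hr1 (fun k => hcauchy k A hA) (hat A hA) n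
  have hsmall : Tendsto (fun n : ℕ => C * r ^ n / (1 - r)) atTop (nhds 0) := by
    simpa using ((tendsto_pow_atTop_nhds_zero_of_lt_one hr0 hr1).const_mul C).div_const (1 - r)
  let s : SignedMeasure α :=
    { measureOf' := a
      empty' := tendsto_nhds_unique (hat ∅ MeasurableSet.empty) (by simp)
      not_measurable' := fun A hA => by simpa [hA] using ha A
      m_iUnion' := by
        intro f hf hd
        have hsum : ∀ t : Finset ℕ, ∑ i ∈ t, a (f i) = a (⋃ i ∈ t, f i) := by
          intro t
          refine tendsto_nhds_unique (tendsto_finsetSum t fun i _ => hat (f i) (hf i)) ?_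
          refine (hat _ (t.measurableSet_biUnion fun i _ => hf i)).congr fun n => ?_
          exact measureReal_biUnion_finset (fun i _ j _ hij => hd hij) fun i _ => hf i
        rw [HasSum, Metric.tendsto_nhds]
        intro δ hδ
        have hδ3 : 0 < δ / 3 := by positivity
        obtain ⟨n, hn⟩ := (hsmall.eventually (gt_mem_nhds hδ3)).exists
        have hnsum : HasSum (fun i => (ν n).real (f i)) ((ν n).real (⋃ i, f i)) := by
          have := (ν n).toSignedMeasure.m_iUnion hf hd
          simpa [Measure.toSignedMeasure_apply_measurable, hf, MeasurableSet.iUnion hf] using this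
        have hev := Metric.tendsto_nhds.1 hnsum (δ / 3) hδ3
        filter_upwards [hev] with t ht
        rw [hsum t]
        have hmt : MeasurableSet (⋃ i ∈ t, f i) := t.measurableSet_biUnion fun i _ => hf i
        have h1 := hunif n _ hmt
        have h2 := hunif n _ (MeasurableSet.iUnion hf)
        rw [← measureReal_biUnion_finset (fun i _ j _ hij => hd hij) fun i _ => hf i] at ht
        rw [dist_comm] at h1
        linarith [dist_triangle4 (a (⋃ i ∈ t, f i)) ((ν n).real (⋃ i ∈ t, f i))
          ((ν n).real (⋃ i, f i)) (a (⋃ i, f i))] }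
  have hs : 0 ≤[Set.univ] s := by
    rw [VectorMeasure.le_restrict_univ_iff_le, VectorMeasure.le_iff]
    intro i _
    exact ha0 i
  have hμ : ∀ A, MeasurableSet A →
      s.toMeasureOfZeroLE Set.univ MeasurableSet.univ hs A = ENNReal.ofReal (a A) := by
    intro A hA
    rw [SignedMeasure.toMeasureOfZeroLE_apply _ _ _ hA, ENNReal.ofReal]
    congr 1
    ext
    simp only [Set.univ_inter, NNReal.coe_mk]
    rw [Real.coe_toNNReal _ (ha0 A)]
    rfl
  refine ⟨s.toMeasureOfZeroLE Set.univ MeasurableSet.univ hs, ⟨?_⟩, fun A hA => ?_⟩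
  · rw [hμ _ MeasurableSet.univ]
    have : a Set.univ = 1 := tendsto_nhds_unique (hat _ MeasurableSet.univ) (by simp)
    simp [this]
  · rw [hμ A hA]
    refine (ENNReal.tendsto_ofReal (hat A hA)).congr fun n => ?_
    simp

/-- Fatou's lemma along a setwise convergent sequence of measures. -/
lemma lintegral_le_liminf_of_setwise {ν : ℕ → Measure α} {μ : Measure α}
    (hν : ∀ A, MeasurableSet A → Tendsto (fun n => ν n A) atTop (nhds (μ A)))
    {f : α → ℝ} (hf : Measurable f) (hf0 : ∀ x, 0 ≤ f x) :
    ∫⁻ x, ENNReal.ofReal (f x) ∂μ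
      ≤ liminf (fun n => ∫⁻ x, ENNReal.ofReal (f x) ∂(ν n)) atTop := by
  simp_rw [lintegral_eq_lintegral_meas_lt _ (ae_of_all _ hf0) hf.aemeasurable]
  have h1 : ∀ t : ℝ, μ {x | t < f x} = liminf (fun n => ν n {x | t < f x}) atTop := fun t =>
    (hν _ (measurableSet_lt measurable_const hf)).liminf_eq.symm
  simp_rw [h1]
  refine lintegral_liminf_le fun n => ?_
  exact Antitone.measurable fun s t hst => measure_mono fun x hx => lt_of_le_of_lt hst hx

end SetwiseLimits

section WeightedNorm

variable {α : Type*} [MeasurableSpace α]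

lemma lintegral_posPart_le {μ ν : Measure α} [IsFiniteMeasure μ] [IsFiniteMeasure ν]
    {V : α → ℝ≥0∞} (hVν : ∫⁻ x, V x ∂ν ≠ ∞) {δ : ℝ≥0∞}
    (h : ∀ A, MeasurableSet A → ∫⁻ x in A, V x ∂μ ≤ ∫⁻ x in A, V x ∂ν + δ) :
    ∫⁻ x, V x ∂(μ.toSignedMeasure - ν.toSignedMeasure).toJordanDecomposition.posPart ≤ δ := by
  obtain ⟨i, hi, hpos, -, hp, -⟩ :=
    (μ.toSignedMeasure - ν.toSignedMeasure).toJordanDecomposition_spec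
  rw [hp]
  have hadd : ν.restrict i
      + (μ.toSignedMeasure - ν.toSignedMeasure).toMeasureOfZeroLE i hi hpos = μ.restrict i := by
    ext A hA
    rw [Measure.add_apply, Measure.restrict_apply hA, Measure.restrict_apply hA]
    have h1 := SignedMeasure.toMeasureOfZeroLE_real_apply _ hpos hi hA
    rw [Measure.toSignedMeasure_sub_apply (hi.inter hA), Set.inter_comm] at h1
    rw [← ENNReal.toReal_eq_toReal_iff' (by finiteness) (by finiteness),
      ENNReal.toReal_add (by finiteness) (by finiteness)]
    simp only [← measureReal_def]
    rw [h1]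
    ring
  have hfin : ∫⁻ x in i, V x ∂ν ≠ ∞ := ne_top_of_le_ne_top hVν (setLIntegral_le_lintegral _ _)
  have := h i hi
  rw [← hadd, lintegral_add_measure] at this
  exact (ENNReal.add_le_add_iff_left hfin).1 this

/-- The weighted total variation distance is controlled by the integrals of the weight over
measurable sets. -/
lemma vNorm_le {μ ν : Measure α} [hμ : IsFiniteMeasure μ] [hν : IsFiniteMeasure ν] {V : α → ℝ}
    (hVμ : ∫⁻ x, ENNReal.ofReal (V x) ∂μ ≠ ∞) (hVν : ∫⁻ x, ENNReal.ofReal (V x) ∂ν ≠ ∞)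
    {δ : ℝ≥0∞}
    (h₁ : ∀ A, MeasurableSet A →
      ∫⁻ x in A, ENNReal.ofReal (V x) ∂μ ≤ ∫⁻ x in A, ENNReal.ofReal (V x) ∂ν + δ)
    (h₂ : ∀ A, MeasurableSet A →
      ∫⁻ x in A, ENNReal.ofReal (V x) ∂ν ≤ ∫⁻ x in A, ENNReal.ofReal (V x) ∂μ + δ) :
    vNorm μ ν V ≤ δ + δ := by
  have hneg : (μ.toSignedMeasure - ν.toSignedMeasure).toJordanDecomposition.negPart
      = (ν.toSignedMeasure - μ.toSignedMeasure).toJordanDecomposition.posPart := by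
    rw [← neg_sub, SignedMeasure.toJordanDecomposition_neg]
    rfl
  rw [vNorm, dif_pos ⟨hμ, hν⟩, SignedMeasure.totalVariation, lintegral_add_measure, hneg]
  exact add_le_add (lintegral_posPart_le hVν h₁) (lintegral_posPart_le hVμ h₂)

end WeightedNorm

section Harris

variable {α : Type*} [MeasurableSpace α] {Q : Kernel α α}

lemma bind_kiter_of_invariant {ν : Measure α} (hν : ν.bind (fun x => Q x) = ν) (n : ℕ) :
    ν.bind (fun x => kiter Q n x) = ν := by
  induction n with
  | zero => simp [kiter]
  | succ n ih =>
    have h1 : (fun x => kiter Q (n + 1) x) = fun x => (Q x).bind (fun y => kiter Q n y) :=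
      funext fun x => Kernel.comp_apply _ _ _
    rw [h1, ← Measure.bind_bind Q.measurable.aemeasurable (kiter Q n).measurable.aemeasurable,
      hν, ih]

lemma integral_kiter_of_invariant {ν : Measure α} (hν : ν.bind (fun x => Q x) = ν)
    {f : α → ℝ} (hf : Integrable f ν) (n : ℕ) :
    ∫ x, ∫ y, f y ∂(kiter Q n x) ∂ν = ∫ x, f x ∂ν := by
  have hcomp : ((kiter Q n).comp (Kernel.const Unit ν)) () = ν := by
    rw [Kernel.comp_apply, Kernel.const_apply]
    exact bind_kiter_of_invariant hν n
  have := Kernel.integral_comp (η := kiter Q n) (κ := Kernel.const Unit ν) (a := ()) (f := f)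
    (by rwa [hcomp])
  rw [hcomp] at this
  rw [this, Kernel.const_apply]

/-- **Harris' theorem**: a geometric drift condition together with a minorization condition on a
large sublevel set of the Lyapunov function implies geometric ergodicity. -/
theorem isGeomErgodic_of_drift_of_minorization [Nonempty α] [IsMarkovKernel Q]
    {V : α → ℝ} (hVm : Measurable V) (hV1 : ∀ x, 1 ≤ V x)
    {l K : ℝ} (hl0 : 0 ≤ l) (hl1 : l < 1) (hK : 0 ≤ K)
    (hdrift : ∀ x, ∫⁻ y, ENNReal.ofReal (V y) ∂(Q x) ≤ ENNReal.ofReal (l * V x + K))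
    {R : ℝ} (hR : 2 * K < (1 - l) * R)
    {m : Measure α} [IsProbabilityMeasure m] {ε : ℝ} (hε : 0 < ε)
    (hminor : ∀ x, V x ≤ R → ENNReal.ofReal ε • m ≤ Q x) : IsGeomErgodic Q := by
  have hV0 : ∀ x, 0 ≤ V x := fun x => zero_le_one.trans (hV1 x)
  have hVi_of : ∀ μ : Measure α, ∫⁻ y, ENNReal.ofReal (V y) ∂μ ≠ ∞ → Integrable V μ :=
    fun μ h => (lintegral_ofReal_ne_top_iff_integrable hVm.aestronglyMeasurable
      (ae_of_all _ hV0)).1 h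
  have hfin : ∀ n x, ∫⁻ y, ENNReal.ofReal (V y) ∂(kiter Q n x) ≠ ∞ := fun n x =>
    ne_top_of_le_ne_top ENNReal.ofReal_ne_top
      (lintegral_kiter_le hVm hV0 hl0 hl1 hK hdrift n x)
  have hQi : ∀ x, Integrable V (Q x) := fun x =>
    hVi_of _ (ne_top_of_le_ne_top ENNReal.ofReal_ne_top (hdrift x))
  have hQd : ∀ x, ∫ y, V y ∂(Q x) ≤ l * V x + K := fun x => by
    have h0 : 0 ≤ l * V x + K := add_nonneg (mul_nonneg hl0 (hV0 x)) hK
    rw [integral_eq_lintegral_of_nonneg_ae (ae_of_all _ hV0) hVm.aestronglyMeasurable]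
    exact ENNReal.toReal_le_of_le_ofReal h0 (hdrift x)
  obtain ⟨b, ρ, hb, hρ0, hρ1, hcontr⟩ :=
    exists_weighted_contraction hV0 hQi hl0 hl1 hK hQd hR hε hminor
  have hw0 : ∀ x, 0 ≤ 1 + b * V x := fun x => by have := hV0 x; positivity
  have hwi : ∀ μ : Measure α, IsProbabilityMeasure μ → Integrable V μ →
      Integrable (fun x => 1 + b * V x) μ := fun μ _ h =>
    (integrable_const _).add (h.const_mul b)
  have hφi : ∀ (φ : α → ℝ) (L : ℝ), Measurable φ → (∀ x, |φ x| ≤ L * (1 + b * V x)) →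
      ∀ μ : Measure α, IsProbabilityMeasure μ → Integrable V μ → Integrable φ μ :=
    fun φ L hφ hφL μ _ h => ((hwi μ inferInstance h).const_mul L).mono' hφ.aestronglyMeasurable
      (ae_of_all _ hφL)
  have hki : ∀ n x, Integrable V (kiter Q n x) := fun n x => hVi_of _ (hfin n x)
  have hstep : ∀ (φ : α → ℝ) (L : ℝ), Measurable φ → (∀ x, |φ x| ≤ L * (1 + b * V x)) →
      ∀ n x, ∫ y, φ y ∂(kiter Q (n + 1) x) = ∫ z, ∫ y, φ y ∂(kiter Q n z) ∂(Q x) :=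
    fun φ L hφ hφL n x => Kernel.integral_comp
      (hφi φ L hφ hφL (kiter Q (n + 1) x) inferInstance (hki (n + 1) x))
  have hmeas : ∀ (φ : α → ℝ), Measurable φ → ∀ n,
      Measurable fun x => ∫ y, φ y ∂(kiter Q n x) := fun φ hφ n =>
    (hφ.stronglyMeasurable.integral_kernel).measurable
  have hiter : ∀ (φ : α → ℝ) (L : ℝ), 0 ≤ L → Measurable φ →
      (∀ x, |φ x| ≤ L * (1 + b * V x)) →
      ∀ n, ∃ c, ∀ x, |∫ y, φ y ∂(kiter Q n x) - c| ≤ ρ ^ n * L * (1 + b * V x) := by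
    intro φ L hL hφ hφL n
    induction n with
    | zero =>
      refine ⟨0, fun x => ?_⟩
      simp only [kiter, Kernel.id_apply, sub_zero, pow_zero, one_mul]
      rw [integral_dirac' _ _ hφ.stronglyMeasurable]
      exact hφL x
    | succ n ih =>
      obtain ⟨c, hc⟩ := ih
      obtain ⟨c', hc'⟩ := hcontr _ _ c (hmeas φ hφ n) (by positivity) hc
      refine ⟨c', fun x => ?_⟩
      rw [hstep φ L hφ hφL n x, pow_succ', mul_assoc ρ]
      exact hc' x
  have havg : ∀ (f : α → ℝ) (c D : ℝ), Measurable f → (∀ x, |f x - c| ≤ D * (1 + b * V x)) →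
      ∀ μ : Measure α, IsProbabilityMeasure μ → Integrable V μ →
      |∫ x, f x ∂μ - c| ≤ D * ∫ x, (1 + b * V x) ∂μ := by
    intro f c D hf hfD μ _ hμ
    have hi := hφi (fun x => f x - c) D (hf.sub_const c) hfD μ inferInstance hμ
    have hi' : Integrable f μ := by
      refine (hi.add (integrable_const c)).congr (ae_of_all _ fun y => ?_)
      simp
    have : ∫ x, f x ∂μ - c = ∫ x, (f x - c) ∂μ := by
      rw [integral_sub hi' (integrable_const c)]
      simp
    rw [this, ← integral_const_mul]
    exact (abs_integral_le_integral_abs).trans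
      (integral_mono hi.abs ((hwi μ inferInstance hμ).const_mul D) hfD)
  obtain ⟨x₀⟩ := ‹Nonempty α›
  set W₀ : ℝ := (1 + b * V x₀) + ∫ x, (1 + b * V x) ∂(Q x₀) with hW₀
  have hcauchy : ∀ n A, MeasurableSet A →
      dist ((kiter Q n x₀).real A) ((kiter Q (n + 1) x₀).real A) ≤ W₀ * ρ ^ n := by
    intro n A hA
    have hφ : Measurable (A.indicator (1 : α → ℝ)) := measurable_one.indicator hA
    have hφ1 : ∀ x, |A.indicator (1 : α → ℝ) x| ≤ 1 * (1 + b * V x) := fun x => by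
      have := mul_nonneg hb.le (hV0 x)
      by_cases hx : x ∈ A <;> simp [hx] <;> linarith
    obtain ⟨c, hc⟩ := hiter _ 1 zero_le_one hφ hφ1 n
    have h1 := hc x₀
    have h2 := havg _ c _ (hmeas _ hφ n) hc (Q x₀) inferInstance (hQi x₀)
    rw [← hstep _ 1 hφ hφ1 n x₀] at h2
    rw [integral_indicator_one hA] at h1 h2
    rw [Real.dist_eq]
    rw [abs_le] at h1 h2 ⊢
    constructor <;> rw [hW₀] <;> nlinarith
  obtain ⟨ν, hνp, hν⟩ := exists_setwise_limit hρ0 hρ1 hcauchy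
  have hinv : ν.bind (fun x => Q x) = ν := by
    have : IsProbabilityMeasure (ν.bind fun x => Q x) :=
      inferInstanceAs (IsProbabilityMeasure (ν.bind Q))
    refine Measure.eq_of_le_of_isProbabilityMeasure (Measure.le_iff.2 fun A hA => ?_)
    rw [Measure.bind_apply hA Q.measurable.aemeasurable]
    have h1 := lintegral_le_liminf_of_setwise hν (f := fun x => (Q x).real A)
      (Q.measurable_coe hA).ennreal_toReal fun x => measureReal_nonneg
    have h0 : ∀ x, ENNReal.ofReal ((Q x).real A) = Q x A := fun x => ofReal_measureReal
    simp_rw [h0] at h1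
    refine h1.trans (le_of_eq ?_)
    have h2 : ∀ n, ∫⁻ x, Q x A ∂(kiter Q n x₀) = kiter Q (n + 1) x₀ A := fun n => by
      rw [kiter_succ', Kernel.comp_apply' _ _ _ hA]
    simp_rw [h2]
    exact ((tendsto_add_atTop_iff_nat 1).2 (hν A hA)).liminf_eq
  have hνfin : ∫⁻ x, ENNReal.ofReal (V x) ∂ν ≠ ∞ := by
    refine ne_top_of_le_ne_top (ENNReal.ofReal_ne_top (r := V x₀ + K / (1 - l)))
      ((lintegral_le_liminf_of_setwise hν hVm hV0).trans ?_)
    refine liminf_le_of_le (by isBoundedDefault) fun B hB => ?_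
    obtain ⟨n, hn⟩ := hB.exists
    refine hn.trans ((lintegral_kiter_le hVm hV0 hl0 hl1 hK hdrift n x₀).trans ?_)
    apply ENNReal.ofReal_le_ofReal
    have h1 : l ^ n ≤ 1 := pow_le_one₀ hl0 hl1.le
    have h2 : 0 ≤ l ^ n := pow_nonneg hl0 n
    have h3 : 0 ≤ K / (1 - l) := div_nonneg hK (by linarith)
    have := hV0 x₀
    nlinarith
  have hνV : Integrable V ν := hVi_of ν hνfin
  set W : ℝ := ∫ x, (1 + b * V x) ∂ν with hW
  have hW0 : 0 ≤ W := integral_nonneg hw0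
  have hconv : ∀ (φ : α → ℝ), Measurable φ → (∀ x, |φ x| ≤ V x) → ∀ n x,
      |∫ y, φ y ∂(kiter Q n x) - ∫ y, φ y ∂ν| ≤ (1 + b + W) / b * ρ ^ n * V x := by
    intro φ hφ hφV n x
    have hφb : ∀ x, |φ x| ≤ b⁻¹ * (1 + b * V x) := fun x => by
      have : V x ≤ b⁻¹ * (1 + b * V x) := by
        field_simp
        linarith
      exact (hφV x).trans this
    obtain ⟨c, hc⟩ := hiter φ b⁻¹ (by positivity) hφ hφb n
    have h1 := hc x
    have h2 := havg _ c _ (hmeas φ hφ n) hc ν inferInstance hνV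
    rw [integral_kiter_of_invariant hinv (hφi φ _ hφ hφb ν inferInstance hνV)] at h2
    have h3 : |∫ y, φ y ∂(kiter Q n x) - ∫ y, φ y ∂ν|
        ≤ ρ ^ n * b⁻¹ * (1 + b * V x) + ρ ^ n * b⁻¹ * W := by
      rw [abs_le] at h1 h2 ⊢
      constructor <;> linarith
    refine h3.trans ?_
    have h4 : (1 + b * V x) + W ≤ (1 + b + W) * V x := by nlinarith [hV1 x]
    have h5 : 0 ≤ ρ ^ n * b⁻¹ := by positivity
    calc _ = ρ ^ n * b⁻¹ * ((1 + b * V x) + W) := by ring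
      _ ≤ ρ ^ n * b⁻¹ * ((1 + b + W) * V x) := mul_le_mul_of_nonneg_left h4 h5
      _ = _ := by ring
  set C : ℝ := (1 + b + W) / b with hC
  have hC0 : 0 ≤ C := by positivity
  refine ⟨ν, hνp, hinv, V, hVm, hV1, 2 * C, by positivity, ρ, ⟨hρ0, hρ1⟩, fun x n => ?_⟩
  have hδ0 : 0 ≤ C * ρ ^ n * V x := mul_nonneg (by positivity) (hV0 x)
  have hset : ∀ A, MeasurableSet A → ∀ μ : Measure α, Integrable V μ →
      ∫⁻ y in A, ENNReal.ofReal (V y) ∂μ = ENNReal.ofReal (∫ y, A.indicator V y ∂μ) := by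
    intro A hA μ hμ
    rw [integral_indicator hA, ofReal_integral_eq_lintegral_ofReal hμ.integrableOn
      (ae_of_all _ hV0)]
  have habs : ∀ A, MeasurableSet A →
      |∫ y, A.indicator V y ∂(kiter Q n x) - ∫ y, A.indicator V y ∂ν| ≤ C * ρ ^ n * V x := by
    intro A hA
    refine hconv _ (hVm.indicator hA) (fun y => ?_) n x
    by_cases hy : y ∈ A
    · simp [hy, abs_of_nonneg (hV0 y)]
    · simp [hy, hV0 y]
  have hpos : ∀ (A : Set α) (μ : Measure α), 0 ≤ ∫ y, A.indicator V y ∂μ := fun A μ =>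
    integral_nonneg fun y => Set.indicator_nonneg (fun y _ => hV0 y) y
  have hfinal := vNorm_le (V := V) (δ := ENNReal.ofReal (C * ρ ^ n * V x)) (hfin n x) hνfin
    (fun A hA => by
      rw [hset A hA _ (hki n x), hset A hA _ hνV, ← ENNReal.ofReal_add (hpos A ν) hδ0]
      exact ENNReal.ofReal_le_ofReal (by linarith [(abs_le.1 (habs A hA)).2]))
    (fun A hA => by
      rw [hset A hA _ (hki n x), hset A hA _ hνV, ← ENNReal.ofReal_add (hpos A _) hδ0]
      exact ENNReal.ofReal_le_ofReal (by linarith [(abs_le.1 (habs A hA)).1]))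
  refine hfinal.trans (le_of_eq ?_)
  rw [← ENNReal.ofReal_add hδ0 hδ0]
  congr 1
  ring

end Harris

section Coefficients

lemma exp_sub_one_le_mul_exp (u : ℝ) : Real.exp u - 1 ≤ u * Real.exp u := by
  have h1 : Real.exp u * (-u + 1) ≤ Real.exp u * Real.exp (-u) :=
    mul_le_mul_of_nonneg_left (Real.add_one_le_exp (-u)) (Real.exp_pos u).le
  rw [← Real.exp_add, add_neg_cancel, Real.exp_zero] at h1
  linarith

lemma abs_exp_sub_one_le_mul_exp (u : ℝ) : |Real.exp u - 1| ≤ |u| * Real.exp |u| := by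
  have h1 := exp_sub_one_le_mul_exp u
  have h2 := Real.add_one_le_exp u
  rcases le_total 0 u with hu | hu
  · rw [abs_of_nonneg hu, abs_of_nonneg (by linarith)]
    exact h1
  · have h3 : Real.exp u ≤ 1 := Real.exp_le_one_iff.2 hu
    have h4 : 1 ≤ Real.exp |u| := Real.one_le_exp (abs_nonneg u)
    rw [abs_of_nonpos (by linarith)]
    have h5 : |u| = -u := abs_of_nonpos hu
    nlinarith [abs_nonneg u]

lemma abs_exp_sub_one_sub_le_sq_mul_exp (u : ℝ) :
    |Real.exp u - 1 - u| ≤ u ^ 2 * Real.exp |u| := by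
  have h1 := exp_sub_one_le_mul_exp u
  have h2 := Real.add_one_le_exp u
  rw [abs_of_nonneg (by linarith)]
  calc Real.exp u - 1 - u ≤ u * (Real.exp u - 1) := by linarith
    _ ≤ |u * (Real.exp u - 1)| := le_abs_self _
    _ = |u| * |Real.exp u - 1| := abs_mul _ _
    _ ≤ |u| * (|u| * Real.exp |u|) :=
        mul_le_mul_of_nonneg_left (abs_exp_sub_one_le_mul_exp u) (abs_nonneg u)
    _ = u ^ 2 * Real.exp |u| := by rw [← mul_assoc, ← sq, sq_abs]

lemma abs_T1s_le {h : ℝ} (hh : 0 < h) (t : ℝ) : |T1s t h| ≤ h / 2 * Real.exp (h / 2 * |t|) := by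
  have hu : |h / 2 * t| = h / 2 * |t| := by rw [abs_mul, abs_of_pos (by positivity)]
  unfold T1s
  split_ifs with ht
  · subst ht
    simp [abs_of_pos (half_pos hh)]
  · have := abs_exp_sub_one_le_mul_exp (h / 2 * t)
    rw [abs_div, div_le_iff₀ (abs_pos.2 ht)]
    rw [hu] at this
    linarith

lemma abs_T2s_le {h : ℝ} (hh : 0 < h) (t : ℝ) : |T2s t h| ≤ h / 2 := by
  unfold T2s
  split_ifs with ht
  · simpa using (half_pos hh).le
  · have h1 : 1 - Real.exp (-(h ^ 2 / 4) * t ^ 2) ≤ h / 2 * |t| := by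
      rcases le_total (h / 2 * |t|) 1 with hu | hu
      · have h2 := Real.add_one_le_exp (-(h ^ 2 / 4) * t ^ 2)
        have h3 : 0 ≤ h / 2 * |t| := by positivity
        have h4 : h ^ 2 / 4 * t ^ 2 = (h / 2 * |t|) ^ 2 := by rw [mul_pow, sq_abs]; ring
        nlinarith
      · linarith [Real.exp_pos (-(h ^ 2 / 4) * t ^ 2)]
    have h5 : Real.exp (-(h ^ 2 / 4) * t ^ 2) ≤ 1 := by
      rw [Real.exp_le_one_iff]
      nlinarith [mul_nonneg (sq_nonneg h) (sq_nonneg t)]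
    rw [abs_div, div_le_iff₀ (abs_pos.2 ht), abs_of_nonpos (by linarith)]
    linarith

lemma T2s_nonneg_of_nonpos (h : ℝ) {t : ℝ} (ht : t ≤ 0) : 0 ≤ T2s t h := by
  unfold T2s
  split_ifs
  · exact le_rfl
  · refine div_nonneg_of_nonpos ?_ ht
    have : Real.exp (-(h ^ 2 / 4) * t ^ 2) ≤ 1 := by
      rw [Real.exp_le_one_iff]
      nlinarith [mul_nonneg (sq_nonneg h) (sq_nonneg t)]
    linarith

lemma abs_T3s_le {h : ℝ} (hh : 0 < h) (t : ℝ) :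
    |T3s t h| ≤ h ^ 2 / 4 * Real.exp (h / 2 * |t|) := by
  have hu : |h / 2 * t| = h / 2 * |t| := by rw [abs_mul, abs_of_pos (by positivity)]
  unfold T3s
  split_ifs with ht
  · subst ht
    rw [abs_of_nonneg (by positivity)]
    simp
    nlinarith
  · have := abs_exp_sub_one_sub_le_sq_mul_exp (h / 2 * t)
    rw [abs_div, abs_of_pos (show 0 < t ^ 2 by positivity), div_le_iff₀ (by positivity)]
    rw [hu] at this
    linarith

lemma T1s_le_of_nonpos {h t : ℝ} (ht : t ≤ 0) : T1s t h ≤ h / 2 := by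
  unfold T1s
  split_ifs with ht0
  · exact le_rfl
  · have ht' : t < 0 := lt_of_le_of_ne ht ht0
    rw [div_le_iff_of_neg ht']
    linarith [Real.add_one_le_exp (h / 2 * t)]

lemma le_T1s {h : ℝ} (hh : 0 < h) (t : ℝ) : h / 2 * Real.exp (-(h / 2 * |t|)) ≤ T1s t h := by
  unfold T1s
  split_ifs with ht0
  · simp [ht0]
  · rcases lt_or_gt_of_ne ht0 with ht | ht
    · rw [le_div_iff_of_neg ht, abs_of_neg ht]
      have := exp_sub_one_le_mul_exp (h / 2 * t)
      rw [show -(h / 2 * -t) = h / 2 * t by ring]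
      linarith
    · rw [le_div_iff₀ ht, abs_of_pos ht]
      have h1 := Real.add_one_le_exp (h / 2 * t)
      have h2 : Real.exp (-(h / 2 * t)) ≤ 1 := by
        rw [Real.exp_le_one_iff]
        have : 0 < h / 2 * t := by positivity
        linarith
      have h3 : h / 2 * t * Real.exp (-(h / 2 * t)) ≤ h / 2 * t * 1 :=
        mul_le_mul_of_nonneg_left h2 (by positivity)
      linarith

lemma le_T1s_of_nonneg {h : ℝ} {t : ℝ} (ht : 0 ≤ t) : h / 2 ≤ T1s t h := by
  unfold T1s
  split_ifs with ht0
  · exact le_rfl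
  · have ht' : 0 < t := lt_of_le_of_ne ht (Ne.symm ht0)
    rw [le_div_iff₀ ht']
    linarith [Real.add_one_le_exp (h / 2 * t)]

lemma buoaVar_lower {h : ℝ} (hh : 0 < h) (t : ℝ) :
    h / 2 * Real.exp (-(h * |t|)) ≤ T1s t (2 * h) + 1 / 3 * T2s t (2 * h) := by
  have h2 : 0 < 2 * h := by positivity
  have he : Real.exp (-(h * |t|)) ≤ 1 := by
    rw [Real.exp_le_one_iff]
    have : 0 ≤ h * |t| := by positivity
    linarith
  have hp := Real.exp_pos (-(h * |t|))
  rcases le_total t 0 with ht | ht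
  · have h3 := le_T1s h2 t
    rw [show 2 * h / 2 = h by ring] at h3
    nlinarith [T2s_nonneg_of_nonpos (2 * h) ht]
  · have h3 := le_T1s_of_nonneg (h := 2 * h) ht
    have h4 := (abs_le.1 (abs_T2s_le h2 t)).1
    nlinarith

lemma buoaVar_upper {h : ℝ} (hh : 0 < h) (t : ℝ) :
    T1s t (2 * h) + 1 / 3 * T2s t (2 * h) ≤ h * Real.exp (h * |t|) + h := by
  have h2 : 0 < 2 * h := by positivity
  have h3 := (abs_le.1 (abs_T1s_le h2 t)).2
  rw [show 2 * h / 2 = h by ring] at h3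
  have h4 := (abs_le.1 (abs_T2s_le h2 t)).2
  linarith

lemma buoaVar_upper_of_nonpos {h : ℝ} (hh : 0 < h) {t : ℝ} (ht : t ≤ 0) :
    T1s t (2 * h) + 1 / 3 * T2s t (2 * h) ≤ 2 * h := by
  have h2 : 0 < 2 * h := by positivity
  have h3 := T1s_le_of_nonpos (h := 2 * h) ht
  have h4 := (abs_le.1 (abs_T2s_le h2 t)).2
  linarith

lemma buoaS_sq (π : ℝ → ℝ) {h : ℝ} (hh : 0 < h) (x : ℝ) :
    buoaS π h x ^ 2 = T1s (iteratedDeriv 2 (fun y => Real.log (π y)) x) (2 * h) +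
      1 / 3 * T2s (iteratedDeriv 2 (fun y => Real.log (π y)) x) (2 * h) := by
  refine Real.sq_sqrt (le_trans ?_ (buoaVar_lower hh _))
  positivity

end Coefficients

section LogDensity

lemma deriv_of_eqOn_rpow {f : ℝ → ℝ} {R a p c : ℝ} (hR : 0 < R)
    (hf : ∀ y, R < y → f y = a * y ^ p + c) {y : ℝ} (hy : R < y) :
    deriv f y = a * p * y ^ (p - 1) + 0 := by
  have hev : f =ᶠ[nhds y] fun z => a * z ^ p + c := by
    filter_upwards [lt_mem_nhds hy] with z hz using hf z hz
  rw [hev.deriv_eq]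
  have := ((Real.hasDerivAt_rpow_const (p := p) (Or.inl (hR.trans hy).ne')).const_mul a).add_const c
  rw [this.deriv]
  ring

lemma derivs_of_eqOn_rpow {f : ℝ → ℝ} {R a p c : ℝ} (hR : 0 < R)
    (hf : ∀ y, R < y → f y = a * y ^ p + c) {y : ℝ} (hy : R < y) :
    deriv f y = a * p * y ^ (p - 1) ∧
    iteratedDeriv 2 f y = a * p * (p - 1) * y ^ (p - 2) ∧
    iteratedDeriv 3 f y = a * p * (p - 1) * (p - 2) * y ^ (p - 3) := by
  have h1 : ∀ z, R < z → deriv f z = a * p * z ^ (p - 1) + 0 := fun z => deriv_of_eqOn_rpow hR hf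
  have h2 : ∀ z, R < z → deriv (deriv f) z = a * p * (p - 1) * z ^ (p - 2) + 0 := fun z hz => by
    rw [deriv_of_eqOn_rpow hR h1 hz, show p - 1 - 1 = p - 2 by ring]
  have h3 : deriv (deriv (deriv f)) y = a * p * (p - 1) * (p - 2) * y ^ (p - 3) + 0 := by
    rw [deriv_of_eqOn_rpow hR h2 hy, show p - 2 - 1 = p - 3 by ring]
  refine ⟨by simpa using h1 y hy, ?_, ?_⟩
  · simpa [iteratedDeriv_succ] using h2 y hy
  · simpa [iteratedDeriv_succ] using h3

/-- Outside a bounded interval the derivatives of `g = log π` are determined by `t = g''(x)`: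
`g'(x) = t x / (β - 1)` and `g'''(x) = (β - 2) t / x`. -/
lemma ClassE.exists_derivs_log {β γ : ℝ} {π : ℝ → ℝ} (hβ : 2 < β) (hπ : ClassE β γ π) :
    ∃ R : ℝ, 1 ≤ R ∧ ∀ x : ℝ, R < |x| →
      iteratedDeriv 2 (fun y => Real.log (π y)) x = -(γ * β * (β - 1) * |x| ^ (β - 2)) ∧
      deriv (fun y => Real.log (π y)) x =
        iteratedDeriv 2 (fun y => Real.log (π y)) x * (x / (β - 1)) ∧
      iteratedDeriv 3 (fun y => Real.log (π y)) x =
        iteratedDeriv 2 (fun y => Real.log (π y)) x * ((β - 2) / x) := by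
  obtain ⟨hpos, -, -, R, c₀, hR, htail⟩ := hπ
  have hc₀ : 0 < c₀ := by
    have h1 := hpos R
    rw [htail R (le_abs_self R)] at h1
    exact pos_of_mul_pos_left h1 (Real.exp_pos _).le
  have hlog : ∀ x, R ≤ |x| → Real.log (π x) = -γ * |x| ^ β + Real.log c₀ := fun x hx => by
    rw [htail x hx, Real.log_mul hc₀.ne' (Real.exp_pos _).ne', Real.log_exp, add_comm]
  set R' : ℝ := max R 1 with hR'
  have hR'1 : 1 ≤ R' := le_max_right _ _
  have hR'0 : 0 < R' := by linarith
  have hright : ∀ y, R' < y → Real.log (π y) = -γ * y ^ β + Real.log c₀ := fun y hy => by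
    have h0 : 0 < y := hR'0.trans hy
    have := hlog y ((le_max_left R 1).trans (hy.le.trans (le_abs_self y)))
    rwa [abs_of_pos h0] at this
  have hleft : ∀ y, R' < y → Real.log (π (-y)) = -γ * y ^ β + Real.log c₀ := fun y hy => by
    have h0 : 0 < y := hR'0.trans hy
    have := hlog (-y) (by rw [abs_neg]; exact (le_max_left R 1).trans (hy.le.trans (le_abs_self y)))
    rwa [abs_neg, abs_of_pos h0] at this
  refine ⟨R', hR'1, fun x hx => ?_⟩
  have hp : ∀ y : ℝ, 0 < y → y ^ (β - 1) = y ^ (β - 2) * y ∧ y ^ (β - 2) = y ^ (β - 3) * y := by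
    intro y hy
    constructor
    · rw [← Real.rpow_add_one hy.ne']; congr 1; ring
    · rw [← Real.rpow_add_one hy.ne']; congr 1; ring
  have hβ1 : β - 1 ≠ 0 := by linarith
  rcases le_total 0 x with h0 | h0
  · rw [abs_of_nonneg h0] at hx ⊢
    have hx0 : 0 < x := hR'0.trans hx
    obtain ⟨d1, d2, d3⟩ := derivs_of_eqOn_rpow hR'0 hright hx
    obtain ⟨p1, p2⟩ := hp x hx0
    rw [d1, d2, d3, p1, p2]
    refine ⟨by ring, by field_simp, by field_simp⟩
  · rw [abs_of_nonpos h0] at hx ⊢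
    have hx0 : 0 < -x := hR'0.trans hx
    obtain ⟨d1, d2, d3⟩ := derivs_of_eqOn_rpow (f := fun y => Real.log (π (-y))) hR'0 hleft hx
    obtain ⟨p1, p2⟩ := hp (-x) hx0
    rw [iteratedDeriv_comp_neg _ (fun y => Real.log (π y))] at d2 d3
    rw [deriv_comp_neg (fun y => Real.log (π y))] at d1
    simp only [neg_neg, smul_eq_mul] at d1 d2 d3
    have d1' : deriv (fun y => Real.log (π y)) x = γ * β * (-x) ^ (β - 1) := by linarith
    have d2' : iteratedDeriv 2 (fun y => Real.log (π y)) x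
        = -(γ * β * (β - 1) * (-x) ^ (β - 2)) := by linarith
    have d3' : iteratedDeriv 3 (fun y => Real.log (π y)) x
        = γ * β * (β - 1) * (β - 2) * (-x) ^ (β - 3) := by linarith
    have hx0' : x ≠ 0 := by linarith
    rw [d1', d2', d3', p1, p2]
    refine ⟨rfl, by field_simp, by field_simp⟩

lemma ClassE.exists_derivs_log_bound {β γ : ℝ} {π : ℝ → ℝ} (hπ : ClassE β γ π) (r : ℝ) :
    ∃ M : ℝ, 0 ≤ M ∧ ∀ x : ℝ, |x| ≤ r → |deriv (fun y => Real.log (π y)) x| ≤ M ∧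
      |iteratedDeriv 2 (fun y => Real.log (π y)) x| ≤ M ∧
      |iteratedDeriv 3 (fun y => Real.log (π y)) x| ≤ M := by
  obtain ⟨hpos, hC, -, -⟩ := hπ
  have hg : ContDiff ℝ 3 fun y => Real.log (π y) := hC.log fun x => (hpos x).ne'
  have hb : ∀ n : ℕ, n ≤ 3 → ∃ M : ℝ, ∀ x ∈ Set.Icc (-r) r,
      |iteratedDeriv n (fun y => Real.log (π y)) x| ≤ M := fun n hn =>
    isCompact_Icc.exists_bound_of_continuousOn
      (hg.continuous_iteratedDeriv n (by exact_mod_cast hn)).continuousOn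
  obtain ⟨M1, h1⟩ := hb 1 (by norm_num)
  obtain ⟨M2, h2⟩ := hb 2 (by norm_num)
  obtain ⟨M3, h3⟩ := hb 3 (by norm_num)
  rw [iteratedDeriv_one] at h1
  refine ⟨|M1| + |M2| + |M3|, by positivity, fun x hx => ?_⟩
  have hx' : x ∈ Set.Icc (-r) r := abs_le.1 hx
  have := h1 x hx'
  have := h2 x hx'
  have := h3 x hx'
  have := le_abs_self M1
  have := le_abs_self M2
  have := le_abs_self M3
  have := abs_nonneg M1
  have := abs_nonneg M2
  have := abs_nonneg M3
  refine ⟨?_, ?_, ?_⟩ <;> linarith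

end LogDensity

section ProposalBounds

lemma ClassE.exists_local_bounds {β γ : ℝ} {π : ℝ → ℝ} (hπ : ClassE β γ π) {h : ℝ} (hh : 0 < h)
    (r : ℝ) : ∃ M a B : ℝ, 0 < a ∧ ∀ x : ℝ, |x| ≤ r →
      |buoaMu π h x| ≤ M ∧ a ≤ buoaS π h x ^ 2 ∧ buoaS π h x ^ 2 ≤ B := by
  obtain ⟨M, hM, hb⟩ := hπ.exists_derivs_log_bound r
  refine ⟨r + h / 2 * Real.exp (h / 2 * M) * M + 2 / 3 * (h / 2) * M
    + 1 / 3 * (h ^ 2 / 4 * Real.exp (h / 2 * M)) * M, h / 2 * Real.exp (-(h * M)),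
    h * Real.exp (h * M) + h, by positivity, fun x hx => ?_⟩
  obtain ⟨b1, b2, b3⟩ := hb x hx
  rw [buoaS_sq π hh]
  unfold buoaMu
  set d1 := deriv (fun y => Real.log (π y)) x
  set t := iteratedDeriv 2 (fun y => Real.log (π y)) x
  set d3 := iteratedDeriv 3 (fun y => Real.log (π y)) x
  refine ⟨?_, ?_, ?_⟩
  · have e : Real.exp (h / 2 * |t|) ≤ Real.exp (h / 2 * M) := by gcongr
    have h1 : |T1s t h * d1| ≤ h / 2 * Real.exp (h / 2 * M) * M := by
      rw [abs_mul]
      gcongr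
      exact (abs_T1s_le hh t).trans (by gcongr)
    have h2 : |2 / 3 * T2s t h * d1| ≤ 2 / 3 * (h / 2) * M := by
      rw [abs_mul, abs_mul, abs_of_pos (show (0 : ℝ) < 2 / 3 by norm_num)]
      gcongr
      exact abs_T2s_le hh t
    have h3 : |1 / 3 * T3s t h * d3| ≤ 1 / 3 * (h ^ 2 / 4 * Real.exp (h / 2 * M)) * M := by
      rw [abs_mul, abs_mul, abs_of_pos (show (0 : ℝ) < 1 / 3 by norm_num)]
      gcongr
      exact (abs_T3s_le hh t).trans (by gcongr)
    rw [abs_le] at h1 h2 h3 hx ⊢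
    constructor <;> linarith [h1.1, h1.2, h2.1, h2.2, h3.1, h3.2, hx.1, hx.2]
  · refine le_trans ?_ (buoaVar_lower hh t)
    gcongr
  · refine (buoaVar_upper hh t).trans ?_
    gcongr

/-- Outside a bounded interval the proposal mean contracts, up to an additive constant, and the
proposal variance is bounded. -/
lemma ClassE.exists_tail_bounds {β γ : ℝ} (hγ : 0 < γ) (hβ : 2 < β) {π : ℝ → ℝ}
    (hπ : ClassE β γ π) {h : ℝ} (hh : 0 < h) :
    ∃ R a D : ℝ, 0 ≤ a ∧ a < 1 ∧ ∀ x : ℝ, R < |x| →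
      |buoaMu π h x| ≤ a * |x| + D ∧ buoaS π h x ^ 2 ≤ 2 * h := by
  obtain ⟨R, hR, hd⟩ := hπ.exists_derivs_log hβ
  set A : ℝ := γ * β * (β - 1) with hA
  have hβ1 : 0 < β - 1 := by linarith
  have hA0 : 0 < A := by positivity
  set θ₀ : ℝ := 1 - Real.exp (-(h / 2 * A)) with hθ₀
  have hθ₀pos : 0 < θ₀ := by
    have : Real.exp (-(h / 2 * A)) < 1 := by
      rw [Real.exp_lt_one_iff]
      have : 0 < h / 2 * A := by positivity
      linarith
    linarith
  refine ⟨R, max (2 / 3) (1 - θ₀ / (β - 1)), h * (β - 2) / 6, le_max_of_le_left (by norm_num),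
    max_lt (by norm_num) (by have := div_pos hθ₀pos hβ1; linarith), fun x hx => ?_⟩
  obtain ⟨e2, e1, e3⟩ := hd x hx
  rw [buoaS_sq π hh]
  unfold buoaMu
  rw [e1, e3]
  set t := iteratedDeriv 2 (fun y => Real.log (π y)) x
  have hx1 : 1 ≤ |x| := hR.trans hx.le
  have hx0 : x ≠ 0 := abs_pos.1 (by linarith)
  have htA : t ≤ -A := by
    rw [e2]
    have : 1 ≤ |x| ^ (β - 2) := Real.one_le_rpow hx1 (by linarith)
    nlinarith
  have ht : t < 0 := by linarith
  refine ⟨?_, buoaVar_upper_of_nonpos hh ht.le⟩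
  set θ : ℝ := (1 - Real.exp (h / 2 * t)) + 2 / 3 * (1 - Real.exp (-(h ^ 2 / 4) * t ^ 2)) with hθ
  have hmu : x + T1s t h * (t * (x / (β - 1))) + 2 / 3 * T2s t h * (t * (x / (β - 1)))
      - 1 / 3 * T3s t h * (t * ((β - 2) / x))
      = x * (1 - θ / (β - 1)) - 1 / 3 * (T3s t h * t) * ((β - 2) / x) := by
    have h1 : T1s t h * t = Real.exp (h / 2 * t) - 1 := by
      rw [T1s, if_neg ht.ne, div_mul_cancel₀ _ ht.ne]
    have h2 : T2s t h * t = Real.exp (-(h ^ 2 / 4) * t ^ 2) - 1 := by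
      rw [T2s, if_neg ht.ne, div_mul_cancel₀ _ ht.ne]
    calc _ = x + (T1s t h * t) * (x / (β - 1)) + 2 / 3 * (T2s t h * t) * (x / (β - 1))
          - 1 / 3 * (T3s t h * t) * ((β - 2) / x) := by ring
      _ = _ := by
        rw [h1, h2, hθ]
        ring
  have hθle : θ ≤ 5 / 3 := by
    have := Real.exp_pos (h / 2 * t)
    have := Real.exp_pos (-(h ^ 2 / 4) * t ^ 2)
    linarith
  have hθge : θ₀ ≤ θ := by
    have h1 : Real.exp (h / 2 * t) ≤ Real.exp (-(h / 2 * A)) := by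
      apply Real.exp_le_exp.2
      nlinarith
    have h2 : Real.exp (-(h ^ 2 / 4) * t ^ 2) ≤ 1 := by
      rw [Real.exp_le_one_iff]
      nlinarith [mul_nonneg (sq_nonneg h) (sq_nonneg t)]
    linarith
  have hcoef : |1 - θ / (β - 1)| ≤ max (2 / 3) (1 - θ₀ / (β - 1)) := by
    rw [abs_le]
    constructor
    · have h1 : θ / (β - 1) ≤ 5 / 3 := by
        rw [div_le_iff₀ hβ1]
        linarith
      linarith [le_max_left (2 / 3 : ℝ) (1 - θ₀ / (β - 1))]
    · have h1 : θ₀ / (β - 1) ≤ θ / (β - 1) := by gcongr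
      linarith [le_max_right (2 / 3 : ℝ) (1 - θ₀ / (β - 1))]
  have hT3 : |T3s t h * t| ≤ h / 2 := by
    have h1 : T3s t h * t = (Real.exp (h / 2 * t) - 1 - h / 2 * t) / t := by
      rw [T3s, if_neg ht.ne]
      field_simp
    have h2 := Real.add_one_le_exp (h / 2 * t)
    have h3 : Real.exp (h / 2 * t) ≤ 1 := by
      rw [Real.exp_le_one_iff]
      exact mul_nonpos_of_nonneg_of_nonpos (by positivity) ht.le
    rw [h1, abs_div, div_le_iff₀ (abs_pos.2 ht.ne), abs_of_nonneg (by linarith), abs_of_neg ht]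
    linarith
  have hrem : |(β - 2) / x| ≤ β - 2 := by
    rw [abs_div, abs_of_pos (by linarith : 0 < β - 2)]
    exact div_le_self (by linarith) hx1
  rw [hmu]
  calc _ ≤ |x * (1 - θ / (β - 1))| + |1 / 3 * (T3s t h * t) * ((β - 2) / x)| := abs_sub _ _
    _ ≤ max (2 / 3) (1 - θ₀ / (β - 1)) * |x| + 1 / 3 * (h / 2) * (β - 2) := by
        rw [abs_mul x, abs_mul, abs_mul (1 / 3 : ℝ), abs_of_pos (show (0 : ℝ) < 1 / 3 by norm_num),
          mul_comm |x|]
        gcongr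
    _ = _ := by ring

lemma ClassE.exists_drift_bounds {β γ : ℝ} (hγ : 0 < γ) (hβ : 2 < β) {π : ℝ → ℝ}
    (hπ : ClassE β γ π) {h : ℝ} (hh : 0 < h) :
    ∃ l K : ℝ, 0 ≤ l ∧ l < 1 ∧ 0 ≤ K ∧ ∀ x : ℝ,
      1 + buoaMu π h x ^ 2 + buoaS π h x ^ 2 ≤ l * (1 + x ^ 2) + K := by
  obtain ⟨R, a, D, ha0, ha1, htail⟩ := hπ.exists_tail_bounds hγ hβ hh
  obtain ⟨M, _, B, -, hloc⟩ := hπ.exists_local_bounds hh R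
  set δ : ℝ := (1 - a ^ 2) / 2 with hδ
  have hδ0 : 0 < δ := by
    have : a ^ 2 < 1 := by nlinarith
    linarith
  refine ⟨a ^ 2 + δ, 1 + M ^ 2 + |B| + a ^ 2 * D ^ 2 / δ + D ^ 2 + 2 * h, by positivity,
    by linarith, by positivity, fun x => ?_⟩
  have hq : 0 ≤ a ^ 2 * D ^ 2 / δ := by positivity
  have hl : 0 ≤ (a ^ 2 + δ) * (1 + x ^ 2) := by positivity
  rcases le_or_gt |x| R with hx | hx
  · obtain ⟨h1, -, h3⟩ := hloc x hx
    have h4 : buoaMu π h x ^ 2 ≤ M ^ 2 := by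
      rw [← sq_abs]
      gcongr
    linarith [le_abs_self B, sq_nonneg D]
  · obtain ⟨h1, h3⟩ := htail x hx
    have h4 : buoaMu π h x ^ 2 ≤ (a * |x| + D) ^ 2 := by
      rw [← sq_abs]
      gcongr
    have h5 : 2 * (a * D) * |x| ≤ δ * |x| ^ 2 + a ^ 2 * D ^ 2 / δ := by
      have h6 : 0 ≤ (δ * |x| - a * D) ^ 2 / δ := by positivity
      have h7 : (δ * |x| - a * D) ^ 2 / δ
          = δ * |x| ^ 2 + a ^ 2 * D ^ 2 / δ - 2 * (a * D) * |x| := by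
        field_simp
        ring
      linarith
    have h8 := sq_abs x
    have h9 := abs_nonneg B
    nlinarith [sq_nonneg M, sq_nonneg a]

end ProposalBounds

section Gaussian

lemma lintegral_one_add_sq_gaussianReal (μ : ℝ) (v : ℝ≥0) :
    ∫⁻ y, ENNReal.ofReal (1 + y ^ 2) ∂(gaussianReal μ v) = ENNReal.ofReal (1 + μ ^ 2 + v) := by
  have hL : MemLp id 2 (gaussianReal μ v) := by
    simpa using memLp_id_gaussianReal (μ := μ) (v := v) 2
  have hsq : Integrable (fun y : ℝ => y ^ 2) (gaussianReal μ v) := by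
    simpa using hL.integrable_sq
  have hvar := variance_eq_sub hL
  rw [variance_id_gaussianReal] at hvar
  have hmean : (gaussianReal μ v)[id] = μ := by simp
  rw [hmean] at hvar
  have hvar' : (v : ℝ) = ∫ y, y ^ 2 ∂(gaussianReal μ v) - μ ^ 2 := by simpa using hvar
  have hint : Integrable (fun y : ℝ => 1 + y ^ 2) (gaussianReal μ v) :=
    (integrable_const 1).add hsq
  rw [← ofReal_integral_eq_lintegral_ofReal hint
    (ae_of_all _ fun y => by positivity), integral_add (integrable_const 1) hsq]
  congr 1
  simp only [integral_const, probReal_univ, one_smul]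
  linarith

/-- Gaussian measures with bounded mean and variance bounded above and below dominate a common
multiple of the uniform measure on `[0, 1]`. -/
lemma smul_volume_restrict_le_gaussianReal {M a B μ : ℝ} {v : ℝ≥0} (ha : 0 < a)
    (hμ : |μ| ≤ M) (hav : a ≤ v) (hvB : v ≤ B) :
    ENNReal.ofReal ((Real.sqrt (2 * Real.pi * B))⁻¹ * Real.exp (-(1 + M) ^ 2 / (2 * a)))
      • (volume.restrict (Set.Icc (0 : ℝ) 1)) ≤ gaussianReal μ v := by
  have hv0 : 0 < (v : ℝ) := ha.trans_le hav
  have hv : v ≠ 0 := by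
    rintro rfl
    simp at hv0
  refine Measure.le_iff.2 fun A hA => ?_
  rw [gaussianReal_apply _ hv, Measure.smul_apply, smul_eq_mul, Measure.restrict_apply hA]
  calc _ = ∫⁻ _ in A ∩ Set.Icc (0 : ℝ) 1, ENNReal.ofReal
          ((Real.sqrt (2 * Real.pi * B))⁻¹ * Real.exp (-(1 + M) ^ 2 / (2 * a))) := by
        rw [setLIntegral_const]
    _ ≤ ∫⁻ y in A ∩ Set.Icc (0 : ℝ) 1, gaussianPDF μ v y := by
        refine setLIntegral_mono (measurable_gaussianPDF μ v) fun y hy => ?_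
        apply ENNReal.ofReal_le_ofReal
        unfold gaussianPDFReal
        obtain ⟨-, hy0, hy1⟩ := hy
        have hsq : (y - μ) ^ 2 ≤ (1 + M) ^ 2 := by
          rw [abs_le] at hμ
          apply sq_le_sq'
          · linarith
          · linarith
        have hfrac : (y - μ) ^ 2 / (2 * v) ≤ (1 + M) ^ 2 / (2 * a) := by gcongr
        have hs : 0 < Real.sqrt (2 * Real.pi * v) := by positivity
        have hexp : Real.exp (-(1 + M) ^ 2 / (2 * a)) ≤ Real.exp (-(y - μ) ^ 2 / (2 * v)) := by
          apply Real.exp_le_exp.2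
          rw [neg_div, neg_div]
          linarith
        gcongr
    _ ≤ ∫⁻ y in A, gaussianPDF μ v y := lintegral_mono_set Set.inter_subset_left

end Gaussian

theorem buoa_geom_ergodic (γ β : ℝ) (hγ : 0 < γ) (hβ : 2 < β)
    (π : ℝ → ℝ) (hπ : ClassE β γ π) (h : ℝ) (hh : 0 < h)
    (Q : Kernel ℝ ℝ)
    (hQ : ∀ x, Q x = gaussianReal (buoaMu π h x) (Real.toNNReal ((buoaS π h x) ^ 2))) :
    IsGeomErgodic Q := by
  obtain ⟨l, K, hl0, hl1, hK, hdrift⟩ := hπ.exists_drift_bounds hγ hβ hh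
  have : IsMarkovKernel Q := ⟨fun x => by rw [hQ x]; infer_instance⟩
  have hR : 2 * K < (1 - l) * ((2 * K + 1) / (1 - l)) := by
    rw [mul_div_cancel₀ _ (by linarith : (1 - l) ≠ 0)]
    linarith
  set R : ℝ := (2 * K + 1) / (1 - l)
  obtain ⟨M, a, B, ha, hloc⟩ := hπ.exists_local_bounds hh (Real.sqrt R)
  have hB : 0 < B := by
    obtain ⟨-, h1, h2⟩ := hloc 0 (by simp)
    linarith
  have : IsProbabilityMeasure (volume.restrict (Set.Icc (0 : ℝ) 1)) := ⟨by simp⟩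
  refine isGeomErgodic_of_drift_of_minorization (V := fun x => 1 + x ^ 2) (by fun_prop)
    (fun x => by nlinarith [sq_nonneg x]) hl0 hl1 hK (fun x => ?_) hR
    (m := volume.restrict (Set.Icc (0 : ℝ) 1))
    (ε := (Real.sqrt (2 * Real.pi * B))⁻¹ * Real.exp (-(1 + M) ^ 2 / (2 * a)))
    (by positivity) (fun x hx => ?_)
  · rw [hQ x, lintegral_one_add_sq_gaussianReal, Real.coe_toNNReal _ (sq_nonneg _)]
    exact ENNReal.ofReal_le_ofReal (hdrift x)
  · obtain ⟨h1, h2, h3⟩ := hloc x (Real.abs_le_sqrt (by linarith))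
    rw [hQ x]
    refine smul_volume_restrict_le_gaussianReal ha h1 ?_ ?_ <;>
      rwa [Real.coe_toNNReal _ (sq_nonneg _)]
end
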